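/- Assume hypotheses (A1) and (A2), and suppose that at least one of the following conditions holds: (D1) F(x) → +∞ as x → +∞, F(x) → −∞ as x → −∞, and x₁* = −x₂*; (D2) F(x) → +∞ as x → +∞, F(x) → −∞ as x → −∞, and x_M = −x_m; (D3) f is nonincreasing on (−∞, 0) and nondecreasing on (0, +∞); (D4) the function x ↦ F(x)/x is nonincreasing on (−∞, 0) and nondecreasing on [x₂*, +∞), and x₂* ≤ −x₁*. Then for every λ > 0 the Liénard system (S1) has at most one periodic orbit: any two nonconstant periodic solutions of (S1) (for the same λ) have the same image. -/

import Mathlib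

open Filter

/-- A nonconstant periodic solution of the Liénard system
`x' = y, y' = -x - λ f(x) y`. -/
def IsPeriodicSol (f : ℝ → ℝ) (lam : ℝ) (x y : ℝ → ℝ) : Prop :=
  (∃ T : ℝ, 0 < T ∧ ∀ t, x (t + T) = x t ∧ y (t + T) = y t) ∧
  (∀ t, HasDerivAt x (y t) t) ∧
  (∀ t, HasDerivAt y (-(x t) - lam * f (x t) * y t) t) ∧
  (∃ t₁ t₂, (x t₁, y t₁) ≠ (x t₂, y t₂))

section

open Set Topology

/-- `u` increases along `[s₀, s₁]`, with positive derivative `u'` in the interior. -/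
structure IncOn (u u' : ℝ → ℝ) (s₀ s₁ : ℝ) : Prop where
  lt : s₀ < s₁
  cont : ContinuousOn u (Icc s₀ s₁)
  deriv : ∀ t ∈ Ioo s₀ s₁, HasDerivAt u (u' t) t
  pos : ∀ t ∈ Ioo s₀ s₁, 0 < u' t

namespace IncOn

variable {u u' u₁ u₁' u₂ u₂' : ℝ → ℝ} {s₀ s₁ r₀ r₁ : ℝ}

theorem strictMonoOn (h : IncOn u u' s₀ s₁) : StrictMonoOn u (Icc s₀ s₁) := by
  apply strictMonoOn_of_deriv_pos (convex_Icc _ _) h.cont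
  intro t ht
  rw [interior_Icc] at ht
  rw [(h.deriv t ht).deriv]
  exact h.pos t ht

theorem mono (h : IncOn u u' s₀ s₁) (hlt : r₀ < r₁) (h₀ : s₀ ≤ r₀) (h₁ : r₁ ≤ s₁) :
    IncOn u u' r₀ r₁ where
  lt := hlt
  cont := h.cont.mono (Icc_subset_Icc h₀ h₁)
  deriv t ht := h.deriv t ⟨h₀.trans_lt ht.1, ht.2.trans_le h₁⟩
  pos t ht := h.pos t ⟨h₀.trans_lt ht.1, ht.2.trans_le h₁⟩

/-- Two increasing parameters with the same range are related by an increasing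
change of time. -/
theorem exists_reparam (h₁ : IncOn u₁ u₁' s₀ s₁) (h₂ : IncOn u₂ u₂' r₀ r₁)
    (hl : u₁ s₀ = u₂ r₀) (hr : u₁ s₁ = u₂ r₁) :
    ∃ σ : ℝ → ℝ, ContinuousOn σ (Icc s₀ s₁) ∧ σ s₀ = r₀ ∧ σ s₁ = r₁ ∧
      (∀ s ∈ Icc s₀ s₁, σ s ∈ Icc r₀ r₁ ∧ u₂ (σ s) = u₁ s) ∧
      (∀ s ∈ Ioo s₀ s₁, σ s ∈ Ioo r₀ r₁ ∧ HasDerivAt σ (u₁' s / u₂' (σ s)) s) := by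
  have m₁ := h₁.strictMonoOn
  have m₂ := h₂.strictMonoOn
  have hs₀ : s₀ ∈ Icc s₀ s₁ := left_mem_Icc.2 h₁.lt.le
  have hs₁ : s₁ ∈ Icc s₀ s₁ := right_mem_Icc.2 h₁.lt.le
  have hr₀ : r₀ ∈ Icc r₀ r₁ := left_mem_Icc.2 h₂.lt.le
  have hr₁ : r₁ ∈ Icc r₀ r₁ := right_mem_Icc.2 h₂.lt.le
  have ex : ∀ s, ∃ r, s ∈ Icc s₀ s₁ → r ∈ Icc r₀ r₁ ∧ u₂ r = u₁ s := by
    intro s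
    by_cases hs : s ∈ Icc s₀ s₁
    · have : u₁ s ∈ Icc (u₂ r₀) (u₂ r₁) := by
        rw [← hl, ← hr]
        exact ⟨m₁.monotoneOn hs₀ hs hs.1, m₁.monotoneOn hs hs₁ hs.2⟩
      obtain ⟨r, hr, hr'⟩ := intermediate_value_Icc h₂.lt.le h₂.cont this
      exact ⟨r, fun _ => ⟨hr, hr'⟩⟩
    · exact ⟨0, fun h => absurd h hs⟩
  choose σ hσ using ex
  have e₀ : σ s₀ = r₀ := m₂.injOn (hσ s₀ hs₀).1 hr₀ ((hσ s₀ hs₀).2.trans hl)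
  have e₁ : σ s₁ = r₁ := m₂.injOn (hσ s₁ hs₁).1 hr₁ ((hσ s₁ hs₁).2.trans hr)
  have mσ : ∀ s ∈ Icc s₀ s₁, ∀ t ∈ Icc s₀ s₁, s < t → σ s < σ t := by
    intro s hs t ht hst
    rw [← m₂.lt_iff_lt (hσ s hs).1 (hσ t ht).1, (hσ s hs).2, (hσ t ht).2]
    exact m₁ hs ht hst
  have cσ : ContinuousOn σ (Icc s₀ s₁) := by
    intro t ht
    rw [ContinuousWithinAt, tendsto_order]
    constructor
    · intro b hb
      rcases lt_or_ge b r₀ with hb₀ | hb₀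
      · filter_upwards [self_mem_nhdsWithin] with s hs
        exact hb₀.trans_le (hσ s hs).1.1
      · have hbm : b ∈ Icc r₀ r₁ := ⟨hb₀, hb.le.trans (hσ t ht).1.2⟩
        have : u₂ b < u₁ t := by
          rw [← (hσ t ht).2]; exact m₂ hbm (hσ t ht).1 hb
        filter_upwards [self_mem_nhdsWithin, (h₁.cont t ht).eventually_const_lt this] with s hs hs'
        rw [← (hσ s hs).2, m₂.lt_iff_lt hbm (hσ s hs).1] at hs'
        exact hs'
    · intro b hb
      rcases lt_or_ge r₁ b with hb₀ | hb₀
      · filter_upwards [self_mem_nhdsWithin] with s hs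
        exact (hσ s hs).1.2.trans_lt hb₀
      · have hbm : b ∈ Icc r₀ r₁ := ⟨(hσ t ht).1.1.trans hb.le, hb₀⟩
        have : u₁ t < u₂ b := by
          rw [← (hσ t ht).2]; exact m₂ (hσ t ht).1 hbm hb
        filter_upwards [self_mem_nhdsWithin, (h₁.cont t ht).eventually_lt_const this] with s hs hs'
        rw [← (hσ s hs).2, m₂.lt_iff_lt (hσ s hs).1 hbm] at hs'
        exact hs'
  refine ⟨σ, cσ, e₀, e₁, fun s hs => hσ s hs, fun s hs => ?_⟩
  have hs' := Ioo_subset_Icc_self hs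
  have hσs : σ s ∈ Ioo r₀ r₁ :=
    ⟨e₀ ▸ mσ s₀ hs₀ s hs' hs.1, e₁ ▸ mσ s hs' s₁ hs₁ hs.2⟩
  refine ⟨hσs, ?_⟩
  have hn : Icc s₀ s₁ ∈ 𝓝 s := Icc_mem_nhds hs.1 hs.2
  refine HasDerivAt.of_comp_left (cσ.continuousAt hn) (h₂.deriv _ hσs) (h₁.deriv s hs)
    (h₂.pos _ hσs).ne' ?_
  filter_upwards [hn] with t ht using (hσ t ht).2

/-- Two quantities measured along a common parameter that never agree keep their order. -/
theorem lt_of_ne {e₁ e₂ : ℝ → ℝ} (h₁ : IncOn u₁ u₁' s₀ s₁) (h₂ : IncOn u₂ u₂' r₀ r₁)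
    (hl : u₁ s₀ = u₂ r₀) (hr : u₁ s₁ = u₂ r₁)
    (c₁ : ContinuousOn e₁ (Icc s₀ s₁)) (c₂ : ContinuousOn e₂ (Icc r₀ r₁))
    (hne : ∀ s ∈ Icc s₀ s₁, ∀ r ∈ Icc r₀ r₁, u₁ s = u₂ r → e₁ s ≠ e₂ r)
    {a b : ℝ} (ha : a ∈ Icc s₀ s₁) (hb : b ∈ Icc r₀ r₁) (hab : u₁ a = u₂ b)
    (hlt : e₁ a < e₂ b) :
    ∀ s ∈ Icc s₀ s₁, ∀ r ∈ Icc r₀ r₁, u₁ s = u₂ r → e₁ s < e₂ r := by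
  obtain ⟨σ, cσ, -, -, hσ, -⟩ := h₁.exists_reparam h₂ hl hr
  have key : ∀ s ∈ Icc s₀ s₁, ∀ r ∈ Icc r₀ r₁, u₁ s = u₂ r → r = σ s := fun s hs r hr h =>
    h₂.strictMonoOn.injOn hr (hσ s hs).1 (h.symm.trans (hσ s hs).2.symm)
  intro s hs r hr hsr
  rw [key s hs r hr hsr]
  rw [key a ha b hb hab] at hlt
  by_contra hcon
  push Not at hcon
  have c : ContinuousOn (fun t => e₂ (σ t) - e₁ t) (Icc s₀ s₁) :=
    (c₂.comp cσ fun t ht => (hσ t ht).1).sub c₁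
  obtain ⟨t, ht, ht'⟩ := isPreconnected_Icc.intermediate_value hs ha c
    (show (0 : ℝ) ∈ Icc _ _ from ⟨by linarith, by linarith⟩)
  exact hne t ht _ (hσ t ht).1 (hσ t ht).2.symm (by simp only at ht'; linarith)

section Compare

variable {e₁ e₂ ρ₁ ρ₂ : ℝ → ℝ}

/-- The quantity growing at the smaller rate, relative to a common parameter, grows less. -/
theorem sub_le_sub_of_rate_le (h₁ : IncOn u₁ u₁' s₀ s₁) (h₂ : IncOn u₂ u₂' r₀ r₁)
    (hl : u₁ s₀ = u₂ r₀) (hr : u₁ s₁ = u₂ r₁)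
    (c₁ : ContinuousOn e₁ (Icc s₀ s₁)) (c₂ : ContinuousOn e₂ (Icc r₀ r₁))
    (d₁ : ∀ s ∈ Ioo s₀ s₁, HasDerivAt e₁ (ρ₁ s * u₁' s) s)
    (d₂ : ∀ r ∈ Ioo r₀ r₁, HasDerivAt e₂ (ρ₂ r * u₂' r) r)
    (hρ : ∀ s ∈ Ioo s₀ s₁, ∀ r ∈ Ioo r₀ r₁, u₁ s = u₂ r → ρ₂ r ≤ ρ₁ s) :
    e₂ r₁ - e₂ r₀ ≤ e₁ s₁ - e₁ s₀ ∧
    ((∃ s ∈ Ioo s₀ s₁, ∀ r ∈ Ioo r₀ r₁, u₁ s = u₂ r → ρ₂ r < ρ₁ s) →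
      e₂ r₁ - e₂ r₀ < e₁ s₁ - e₁ s₀) := by
  obtain ⟨σ, cσ, σ₀, σ₁, hσ, hσ'⟩ := h₁.exists_reparam h₂ hl hr
  have c : ContinuousOn (fun t => e₂ (σ t) - e₁ t) (Icc s₀ s₁) :=
    (c₂.comp cσ fun t ht => (hσ t ht).1).sub c₁
  have d : ∀ s ∈ Ioo s₀ s₁,
      HasDerivAt (fun t => e₂ (σ t) - e₁ t) ((ρ₂ (σ s) - ρ₁ s) * u₁' s) s := by
    intro s hs
    obtain ⟨hm, hd⟩ := hσ' s hs
    refine (((d₂ _ hm).comp s hd).sub (d₁ s hs)).congr_deriv ?_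
    have := (h₂.pos _ hm).ne'
    field_simp
  have anti : AntitoneOn (fun t => e₂ (σ t) - e₁ t) (Icc s₀ s₁) := by
    apply antitoneOn_of_deriv_nonpos (convex_Icc _ _) c
    · rw [interior_Icc]
      exact fun s hs => (d s hs).differentiableAt.differentiableWithinAt
    · rw [interior_Icc]
      intro s hs
      rw [(d s hs).deriv]
      have := hρ s hs _ (hσ' s hs).1 (hσ s (Ioo_subset_Icc_self hs)).2.symm
      exact mul_nonpos_of_nonpos_of_nonneg (by linarith) (h₁.pos s hs).le
  have hs₀ : s₀ ∈ Icc s₀ s₁ := left_mem_Icc.2 h₁.lt.le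
  have hs₁ : s₁ ∈ Icc s₀ s₁ := right_mem_Icc.2 h₁.lt.le
  have le := anti hs₀ hs₁ h₁.lt.le
  simp only [σ₀, σ₁] at le
  refine ⟨by linarith, ?_⟩
  rintro ⟨s, hs, hlt⟩
  rcases (show e₂ r₁ - e₂ r₀ ≤ e₁ s₁ - e₁ s₀ by linarith).lt_or_eq with h | h
  · exact h
  · exfalso
    have hconst : (fun t => e₂ (σ t) - e₁ t) =ᶠ[𝓝 s] fun _ => e₂ r₀ - e₁ s₀ := by
      filter_upwards [Icc_mem_nhds hs.1 hs.2] with t ht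
      have l₁ := anti hs₀ ht ht.1
      have l₂ := anti ht hs₁ ht.2
      simp only [σ₀, σ₁] at l₁ l₂
      linarith
    have := ((hasDerivAt_const s (e₂ r₀ - e₁ s₀)).congr_of_eventuallyEq hconst).unique (d s hs)
    have h' := hlt _ (hσ' s hs).1 (hσ s (Ioo_subset_Icc_self hs)).2.symm
    have := mul_neg_of_neg_of_pos (sub_neg.2 h') (h₁.pos s hs)
    linarith

end Compare

end IncOn

/-- `(x, z)` solves the Liénard system `x' = z - F(x)`, `z' = -x`. -/
structure IsSol (F x z : ℝ → ℝ) : Prop where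
  hx : ∀ t, HasDerivAt x (z t - F (x t)) t
  hz : ∀ t, HasDerivAt z (-(x t)) t

/-- On `[t₀, t₁]` the solution `(x, z)` goes from the positive to the negative `z`-axis through the
half-plane `x > 0`. -/
structure RightArc (F x z : ℝ → ℝ) (t₀ t₁ : ℝ) : Prop extends IsSol F x z where
  lt : t₀ < t₁
  x₀ : x t₀ = 0
  x₁ : x t₁ = 0
  pos : ∀ t ∈ Ioo t₀ t₁, 0 < x t
  z₀ : 0 < z t₀
  z₁ : z t₁ < 0

namespace IsSol

variable {F x z x' z' : ℝ → ℝ}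

theorem neg (h : IsSol F x z) : IsSol (fun u => -F (-u)) (fun t => -x t) (fun t => -z t) where
  hx t := ((h.hx t).neg).congr_deriv (by simp; ring)
  hz t := (h.hz t).neg

theorem rev (h : IsSol F x z) :
    IsSol (fun u => -F u) (fun t => x (-t)) (fun t => -z (-t)) where
  hx t := ((h.hx (-t)).comp t (hasDerivAt_neg t)).congr_deriv (by ring)
  hz t := (((h.hz (-t)).comp t (hasDerivAt_neg t)).neg).congr_deriv (by ring)

theorem shift (h : IsSol F x z) (s : ℝ) :
    IsSol F (fun t => x (s + t)) (fun t => z (s + t)) where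
  hx t := (h.hx (s + t)).comp_const_add s t
  hz t := (h.hz (s + t)).comp_const_add s t

theorem contX (h : IsSol F x z) : Continuous x :=
  continuous_iff_continuousAt.2 fun t => (h.hx t).continuousAt

theorem contZ (h : IsSol F x z) : Continuous z :=
  continuous_iff_continuousAt.2 fun t => (h.hz t).continuousAt

theorem eq_of_eq_zero (hF : ContDiff ℝ 1 F) (h : IsSol F x z) (h' : IsSol F x' z')
    (ex : x 0 = x' 0) (ez : z 0 = z' 0) (t : ℝ) : x t = x' t ∧ z t = z' t := by
  let v : ℝ × ℝ → ℝ × ℝ := fun p => (p.2 - F p.1, -p.1)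
  have hv : ContDiff ℝ 1 v := by fun_prop
  let p : ℝ → ℝ × ℝ := fun t => (x t, z t)
  let q : ℝ → ℝ × ℝ := fun t => (x' t, z' t)
  let I : Set ℝ := Icc (-(|t| + 1)) (|t| + 1)
  have hI : IsCompact I := isCompact_Icc
  have cp : Continuous p := h.contX.prodMk h.contZ
  have cq : Continuous q := h'.contX.prodMk h'.contZ
  obtain ⟨K, hK⟩ := hv.locallyLipschitz.locallyLipschitzOn.exists_lipschitzOnWith_of_compact
    ((hI.image cp).union (hI.image cq))
  have ht : t ∈ I := ⟨by linarith [neg_abs_le t], by linarith [le_abs_self t]⟩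
  have := ODE_solution_unique_of_mem_Icc (v := fun _ => v) (K := K)
    (s := fun _ => p '' I ∪ q '' I) (f := p) (g := q) (t₀ := 0)
    (a := -(|t| + 1)) (b := |t| + 1)
    (fun _ _ => hK) ⟨by linarith [abs_nonneg t], by linarith [abs_nonneg t]⟩ cp.continuousOn
    (fun s _ => (h.hx s).prodMk (h.hz s))
    (fun s hs => Or.inl (mem_image_of_mem _ (Ioo_subset_Icc_self hs))) cq.continuousOn
    (fun s _ => (h'.hx s).prodMk (h'.hz s))
    (fun s hs => Or.inr (mem_image_of_mem _ (Ioo_subset_Icc_self hs)))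
    (Prod.ext ex ez) ht
  exact Prod.ext_iff.1 this

theorem eq_shift (hF : ContDiff ℝ 1 F) (h : IsSol F x z) (h' : IsSol F x' z') {s r : ℝ}
    (ex : x s = x' r) (ez : z s = z' r) (t : ℝ) :
    x (s + t) = x' (r + t) ∧ z (s + t) = z' (r + t) :=
  (h.shift s).eq_of_eq_zero hF (h'.shift r) (by simpa) (by simpa) t

theorem deriv_y {f : ℝ → ℝ} (hf : ∀ u, HasDerivAt F (f u) u) (h : IsSol F x z) (t : ℝ) :
    HasDerivAt (fun t => z t - F (x t)) (-(x t) - f (x t) * (z t - F (x t))) t :=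
  (h.hz t).sub ((hf (x t)).comp t (h.hx t))

theorem deriv_sq (h : IsSol F x z) (t : ℝ) :
    HasDerivAt (fun t => x t ^ 2 + z t ^ 2) (2 * (-(x t * F (x t)))) t :=
  (((h.hx t).pow 2).add ((h.hz t).pow 2)).congr_deriv (by norm_num; ring)

theorem deriv_sq_y {f : ℝ → ℝ} (hf : ∀ u, HasDerivAt F (f u) u) (h : IsSol F x z) (t : ℝ) :
    HasDerivAt (fun t => x t ^ 2 + (z t - F (x t)) ^ 2)
      (2 * (-(f (x t) * (z t - F (x t)) ^ 2))) t :=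
  (((h.hx t).pow 2).add ((h.deriv_y hf t).pow 2)).congr_deriv (by norm_num; ring)

end IsSol

/-- A function whose derivative is negative at each of its zeros on `[a, b)` stays nonpositive. -/
theorem nonpos_of_deriv_neg_at_zeros {g g' : ℝ → ℝ} (hg : ∀ t, HasDerivAt g (g' t) t) {a b : ℝ}
    (ha : g a ≤ 0) (hneg : ∀ t ∈ Ico a b, g t = 0 → g' t < 0) : ∀ t ∈ Icc a b, g t ≤ 0 :=
  fun _ ht => image_le_of_deriv_right_lt_deriv_boundary (B := fun _ => 0) (B' := fun _ => 0)
    (HasDerivAt.continuousOn fun t _ => hg t) (fun t _ => (hg t).hasDerivWithinAt) ha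
    (fun t => hasDerivAt_const t 0) hneg ht

/-- A function with negative derivative at a zero is positive just before it. -/
theorem eventually_pos_of_deriv_neg {g : ℝ → ℝ} {d t : ℝ} (hg : HasDerivAt g d t) (h0 : g t = 0)
    (hd : d < 0) : ∀ᶠ s in 𝓝[<] t, 0 < g s := by
  have := (hasDerivAt_iff_tendsto_slope.1 hg).eventually_lt_const hd
  have := this.filter_mono (nhdsWithin_mono t (fun s (hs : s < t) => hs.ne))
  filter_upwards [this, self_mem_nhdsWithin] with s hs hst
  have hst : s - t < 0 := sub_neg.2 hst
  rw [slope_def_field, h0, sub_zero, div_lt_iff_of_neg hst, zero_mul] at hs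
  exact hs

theorem eventually_neg_of_deriv_neg {g : ℝ → ℝ} {d t : ℝ} (hg : HasDerivAt g d t) (h0 : g t = 0)
    (hd : d < 0) : ∀ᶠ s in 𝓝[>] t, g s < 0 := by
  have := (hasDerivAt_iff_tendsto_slope.1 hg).eventually_lt_const hd
  have := this.filter_mono (nhdsWithin_mono t (fun s (hs : t < s) => hs.ne'))
  filter_upwards [this, self_mem_nhdsWithin] with s hs hst
  have hst : 0 < s - t := sub_pos.2 hst
  rw [slope_def_field, h0, sub_zero, div_lt_iff₀ hst, zero_mul] at hs
  exact hs

namespace RightArc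

variable {F f x z x' z' : ℝ → ℝ} {t₀ t₁ r₀ r₁ : ℝ}

theorem nonneg (A : RightArc F x z t₀ t₁) {t : ℝ} (ht : t ∈ Icc t₀ t₁) : 0 ≤ x t := by
  rcases ht.1.eq_or_lt with h | h
  · rw [← h, A.x₀]
  rcases ht.2.eq_or_lt with h' | h'
  · rw [h', A.x₁]
  exact (A.pos t ⟨h, h'⟩).le

theorem rev (A : RightArc F x z t₀ t₁) :
    RightArc (fun u => -F u) (fun t => x (-t)) (fun t => -z (-t)) (-t₁) (-t₀) where
  toIsSol := A.toIsSol.rev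
  lt := neg_lt_neg A.lt
  x₀ := by simpa using A.x₁
  x₁ := by simpa using A.x₀
  pos t ht := A.pos _ ⟨by linarith [ht.2], by linarith [ht.1]⟩
  z₀ := by simpa using A.z₁
  z₁ := by simpa using A.z₀

theorem incOn_neg_z (A : RightArc F x z t₀ t₁) : IncOn (fun t => -z t) x t₀ t₁ where
  lt := A.lt
  cont := A.contZ.neg.continuousOn
  deriv t _ := ((A.hz t).neg).congr_deriv (by ring)
  pos := A.pos

theorem z_lt (A : RightArc F x z t₀ t₁) {s t : ℝ} (hs : s ∈ Icc t₀ t₁) (ht : t ∈ Icc t₀ t₁)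
    (h : s < t) : z t < z s :=
  neg_lt_neg_iff.1 (A.incOn_neg_z.strictMonoOn hs ht h)

/-- Along a right arc `x` first increases and then decreases. -/
theorem exists_peak (hf : ∀ u, HasDerivAt F (f u) u) (hF0 : F 0 = 0)
    (A : RightArc F x z t₀ t₁) :
    ∃ s ∈ Ioo t₀ t₁, z s = F (x s) ∧ (∀ t ∈ Ico t₀ s, F (x t) < z t) ∧
      (∀ t ∈ Ioc s t₁, z t < F (x t)) := by
  set g : ℝ → ℝ := fun t => z t - F (x t) with hg
  have dg := A.deriv_y hf
  have g₀ : 0 < g t₀ := by simp [hg, A.x₀, hF0, A.z₀]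
  have g₁ : g t₁ < 0 := by simp [hg, A.x₁, hF0, A.z₁]
  have cg : ContinuousOn g (Icc t₀ t₁) := HasDerivAt.continuousOn fun t _ => dg t
  obtain ⟨s, hs, hs0⟩ := intermediate_value_Icc' A.lt.le cg
    (show (0 : ℝ) ∈ Icc _ _ from ⟨g₁.le, g₀.le⟩)
  have hs' : s ∈ Ioo t₀ t₁ := by
    refine ⟨lt_of_le_of_ne hs.1 ?_, lt_of_le_of_ne hs.2 ?_⟩
    · rintro rfl; linarith
    · rintro rfl; linarith
  have hd : ∀ t ∈ Ioo t₀ t₁, g t = 0 → -(x t) - f (x t) * g t < 0 := by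
    intro t ht h
    rw [h]; linarith [A.pos t ht]
  refine ⟨s, hs', by simp only [hg] at hs0; linarith, fun t ht => ?_, fun t ht => ?_⟩
  · suffices 0 < g t by simp only [hg] at this; linarith
    by_contra hcon
    push Not at hcon
    have hne : t₀ < t := lt_of_le_of_ne ht.1 (by rintro rfl; linarith)
    have := nonpos_of_deriv_neg_at_zeros dg hcon (b := s)
      (fun r hr => hd r ⟨hne.trans_le hr.1, hr.2.trans hs'.2⟩)
    obtain ⟨r, hr, hr'⟩ := ((eventually_pos_of_deriv_neg (dg s) hs0 (hd s hs' hs0)).and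
      (Ioo_mem_nhdsLT ht.2)).exists
    linarith [this r ⟨hr'.1.le, hr'.2.le⟩]
  · suffices g t < 0 by simp only [hg] at this; linarith
    have := nonpos_of_deriv_neg_at_zeros dg hs0.le (b := t₁)
      (fun r hr => hd r ⟨hs'.1.trans_le hr.1, hr.2⟩)
    refine lt_of_le_of_ne (this t ⟨ht.1.le, ht.2⟩) fun h0 => ?_
    have ht' : t ∈ Ioo t₀ t₁ :=
      ⟨hs'.1.trans ht.1, lt_of_le_of_ne ht.2 (by rintro rfl; linarith)⟩
    obtain ⟨r, hr, hr'⟩ := ((eventually_pos_of_deriv_neg (dg t) h0 (hd t ht' h0)).and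
      (Ioo_mem_nhdsLT ht.1)).exists
    linarith [this r ⟨hr'.1.le, hr'.2.le.trans ht.2⟩]

/-- Right arcs through a common point leave the `z`-axis at the same point. -/
theorem start_eq (hF : ContDiff ℝ 1 F) (A : RightArc F x z t₀ t₁) (B : RightArc F x' z' r₀ r₁)
    {s r : ℝ} (hs : s ∈ Icc t₀ t₁) (hr : r ∈ Icc r₀ r₁) (ex : x s = x' r) (ez : z s = z' r) :
    z t₀ = z' r₀ := by
  have key := A.toIsSol.eq_shift hF B.toIsSol ex ez
  have hA : ∀ t ∈ Ioc t₀ t₁, x t = 0 → t = t₁ := fun t ht h0 => by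
    by_contra h
    exact (A.pos t ⟨ht.1, lt_of_le_of_ne ht.2 h⟩).ne' h0
  have hB : ∀ t ∈ Ioc r₀ r₁, x' t = 0 → t = r₁ := fun t ht h0 => by
    by_contra h
    exact (B.pos t ⟨ht.1, lt_of_le_of_ne ht.2 h⟩).ne' h0
  rcases lt_trichotomy (t₀ - s) (r₀ - r) with h | h | h
  · exfalso
    obtain ⟨kx, kz⟩ := key (r₀ - r)
    rw [add_sub_cancel, B.x₀] at kx
    rw [add_sub_cancel] at kz
    have := hA _ ⟨by linarith, by linarith [hs.2, hr.1]⟩ kx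
    rw [this] at kz
    linarith [A.z₁, B.z₀]
  · have := (key (t₀ - s)).2
    rw [h, add_sub_cancel, ← h, add_sub_cancel] at this
    exact this
  · exfalso
    obtain ⟨kx, kz⟩ := key (t₀ - s)
    rw [add_sub_cancel, A.x₀] at kx
    rw [add_sub_cancel] at kz
    have := hB _ ⟨by linarith, by linarith [hr.2, hs.1]⟩ kx.symm
    rw [this] at kz
    linarith [B.z₁, A.z₀]

/-- Existence of the time at which an arc has a prescribed height. -/
theorem exists_z_eq (A : RightArc F x z t₀ t₁) {c : ℝ} (h : c ∈ Icc (z t₁) (z t₀)) :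
    ∃ t ∈ Icc t₀ t₁, z t = c :=
  intermediate_value_Icc' A.lt.le A.contZ.continuousOn h

/-- The transition map from the positive to the negative `z`-axis is increasing. -/
theorem end_lt (hF : ContDiff ℝ 1 F) (A : RightArc F x z t₀ t₁) (B : RightArc F x' z' r₀ r₁)
    (h : z t₀ < z' r₀) : z' r₁ < z t₁ := by
  by_contra hcon
  push Not at hcon
  obtain ⟨r, hr, hrz⟩ := B.exists_z_eq (c := z t₀) ⟨by linarith [A.z₀, B.z₁], h.le⟩
  obtain ⟨s, hs, hsz⟩ := A.exists_z_eq (c := z' r₁) ⟨hcon, by linarith [A.z₀, B.z₁]⟩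
  have hr' : r ∈ Ioo r₀ r₁ := ⟨lt_of_le_of_ne hr.1 (by rintro rfl; linarith),
    lt_of_le_of_ne hr.2 (by rintro rfl; linarith [A.z₀, B.z₁])⟩
  have hs' : t₀ < s := lt_of_le_of_ne hs.1 (by rintro rfl; linarith [A.z₀, B.z₁])
  have := (A.incOn_neg_z.mono hs' le_rfl hs.2).lt_of_ne (B.incOn_neg_z.mono hr'.2 hr.1 le_rfl)
    (by simp [hrz]) (by simp [hsz]) A.contX.continuousOn B.contX.continuousOn
    (fun a ha b hb hab hx => h.ne (A.start_eq hF B ⟨ha.1, ha.2.trans hs.2⟩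
      ⟨hr.1.trans hb.1, hb.2⟩ hx (neg_injective hab)))
    (a := t₀) (b := r) ⟨le_rfl, hs'.le⟩ ⟨le_rfl, hr.2⟩ (by simp [hrz])
    (by rw [A.x₀]; exact B.pos r hr') s ⟨hs'.le, le_rfl⟩ r₁ ⟨hr.2, le_rfl⟩ (by simp [hsz])
  rw [B.x₁] at this
  linarith [A.nonneg hs]

/-- At equal heights the outer arc is farther from the `z`-axis. -/
theorem x_lt_of_z_eq (hF : ContDiff ℝ 1 F) (A : RightArc F x z t₀ t₁)
    (B : RightArc F x' z' r₀ r₁) (h : z t₀ < z' r₀) {s r : ℝ} (hs : s ∈ Icc t₀ t₁)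
    (hr : r ∈ Icc r₀ r₁) (hz : z s = z' r) : x s < x' r := by
  have hb := A.end_lt hF B h
  obtain ⟨a, ha, haz⟩ := B.exists_z_eq (c := z t₀) ⟨by linarith [A.z₀, B.z₁], h.le⟩
  obtain ⟨b, hb, hbz⟩ := B.exists_z_eq (c := z t₁) ⟨hb.le, by linarith [A.z₁, B.z₀]⟩
  have ha' : a ∈ Ioo r₀ r₁ := ⟨lt_of_le_of_ne ha.1 (by rintro rfl; linarith),
    lt_of_le_of_ne ha.2 (by rintro rfl; linarith [A.z₀, B.z₁])⟩
  have m := B.incOn_neg_z.strictMonoOn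
  have hab : a < b := by
    rw [← m.lt_iff_lt ha hb]
    simp only [haz, hbz]
    linarith [A.z₀, A.z₁]
  refine A.incOn_neg_z.lt_of_ne (B.incOn_neg_z.mono hab ha.1 hb.2)
    (by simp [haz]) (by simp [hbz]) A.contX.continuousOn B.contX.continuousOn
    (fun c hc d hd hcd hx => h.ne (A.start_eq hF B hc
      ⟨ha.1.trans hd.1, hd.2.trans hb.2⟩ hx (neg_injective hcd)))
    (a := t₀) (b := a) ⟨le_rfl, A.lt.le⟩ ⟨le_rfl, hab.le⟩ (by simp [haz])
    (by rw [A.x₀]; exact B.pos a ha') s hs r ?_ (by simp [hz])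
  have mA := A.incOn_neg_z.strictMonoOn.monotoneOn
  have l₁ := mA ⟨le_rfl, A.lt.le⟩ hs hs.1
  have l₂ := mA hs ⟨A.lt.le, le_rfl⟩ hs.2
  constructor
  · rw [← m.le_iff_le ha hr]; simp only at *; linarith
  · rw [← m.le_iff_le hr hb]; simp only at *; linarith

end RightArc

theorem lt_of_deriv_nonneg_of_pos {g g' : ℝ → ℝ} (hg : ∀ t, HasDerivAt g (g' t) t) {a b c : ℝ}
    (hnn : ∀ t ∈ Ioo a b, 0 ≤ g' t) (hc : c ∈ Ioo a b) (hpos : 0 < g' c) : g a < g b := by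
  have mono : MonotoneOn g (Icc a b) := by
    apply monotoneOn_of_deriv_nonneg (convex_Icc _ _) (HasDerivAt.continuousOn fun t _ => hg t)
    · exact fun t _ => (hg t).differentiableAt.differentiableWithinAt
    · rw [interior_Icc]
      intro t ht
      rw [(hg t).deriv]
      exact hnn t ht
  have hab := hc.1.trans hc.2
  rcases (mono (left_mem_Icc.2 hab.le) (right_mem_Icc.2 hab.le) hab.le).lt_or_eq with h | h
  · exact h
  · exfalso
    have : g =ᶠ[𝓝 c] fun _ => g a := by
      filter_upwards [Icc_mem_nhds hc.1 hc.2] with t ht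
      have l₁ := mono (left_mem_Icc.2 hab.le) ht ht.1
      have l₂ := mono ht (right_mem_Icc.2 hab.le) ht.2
      linarith
    have := ((hasDerivAt_const c (g a)).congr_of_eventuallyEq this).unique (hg c)
    linarith

theorem le_of_deriv_nonneg {g g' : ℝ → ℝ} (hg : ∀ t, HasDerivAt g (g' t) t) {a b : ℝ}
    (hab : a ≤ b) (hnn : ∀ t ∈ Ioo a b, 0 ≤ g' t) : g a ≤ g b := by
  refine monotoneOn_of_deriv_nonneg (convex_Icc a b) (HasDerivAt.continuousOn fun t _ => hg t)
    (fun t _ => (hg t).differentiableAt.differentiableWithinAt) ?_ (left_mem_Icc.2 hab)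
    (right_mem_Icc.2 hab) hab
  rw [interior_Icc]
  intro t ht
  rw [(hg t).deriv]
  exact hnn t ht

namespace RightArc

variable {F f x z x' z' : ℝ → ℝ} {t₀ t₁ r₀ r₁ : ℝ}

theorem exists_small (A : RightArc F x z t₀ t₁) {α s : ℝ} (hα : 0 < α) (hs : t₀ < s) :
    ∃ t ∈ Ioo t₀ s, x t < α := by
  have h : ∀ᶠ t in 𝓝[>] t₀, x t < α :=
    (A.contX.continuousAt.eventually_lt_const (by rw [A.x₀]; exact hα)).filter_mono
      nhdsWithin_le_nhds
  obtain ⟨t, ht, ht'⟩ := (h.and (Ioo_mem_nhdsGT hs)).exists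
  exact ⟨t, ht', ht⟩

theorem incOn_x (A : RightArc F x z t₀ t₁) {a b : ℝ} (hab : a < b)
    (h : ∀ t ∈ Ioo a b, F (x t) < z t) : IncOn x (fun t => z t - F (x t)) a b where
  lt := hab
  cont := A.contX.continuousOn
  deriv t _ := A.hx t
  pos t ht := sub_pos.2 (h t ht)

theorem incOn_neg_x (A : RightArc F x z t₀ t₁) {a b : ℝ} (hab : a < b)
    (h : ∀ t ∈ Ioo a b, z t < F (x t)) :
    IncOn (fun t => -x t) (fun t => -(z t - F (x t))) a b where
  lt := hab
  cont := A.contX.neg.continuousOn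
  deriv t _ := (A.hx t).neg
  pos t ht := by linarith [h t ht]

/-- On the rising parts of two arcs, the outer one is above the inner one. -/
theorem z_lt_of_x_eq (hF : ContDiff ℝ 1 F) (A : RightArc F x z t₀ t₁)
    (B : RightArc F x' z' r₀ r₁) (h : z t₀ < z' r₀) {s r : ℝ}
    (hs : s ∈ Icc t₀ t₁) (hr : r ∈ Icc r₀ r₁)
    (iA : ∀ t ∈ Ioo t₀ s, F (x t) < z t) (iB : ∀ t ∈ Ioo r₀ r, F (x' t) < z' t)
    (e : x s = x' r) : z s < z' r := by
  rcases hs.1.eq_or_lt with rfl | hs'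
  · rw [A.x₀] at e
    rcases hr.1.eq_or_lt with rfl | hr'
    · exact h
    · have := (B.incOn_x hr' iB).strictMonoOn ⟨le_rfl, hr.1⟩ ⟨hr.1, le_rfl⟩ hr'
      rw [B.x₀, ← e] at this
      exact absurd this (lt_irrefl _)
  rcases hr.1.eq_or_lt with rfl | hr'
  · have := (A.incOn_x hs' iA).strictMonoOn ⟨le_rfl, hs.1⟩ ⟨hs.1, le_rfl⟩ hs'
    rw [A.x₀, e, B.x₀] at this
    exact absurd this (lt_irrefl _)
  exact (A.incOn_x hs' iA).lt_of_ne (B.incOn_x hr' iB) (by rw [A.x₀, B.x₀]) e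
    A.contZ.continuousOn B.contZ.continuousOn
    (fun c hc d hd hcd hz => h.ne (A.start_eq hF B ⟨hc.1, hc.2.trans hs.2⟩
      ⟨hd.1, hd.2.trans hr.2⟩ hcd hz)) (a := t₀) (b := r₀) ⟨le_rfl, hs.1⟩ ⟨le_rfl, hr.1⟩
    (by rw [A.x₀, B.x₀]) h s ⟨hs.1, le_rfl⟩ r ⟨hr.1, le_rfl⟩ e

/-- On the falling parts of two arcs, the outer one is below the inner one. -/
theorem z_lt_of_x_eq' (hF : ContDiff ℝ 1 F) (A : RightArc F x z t₀ t₁)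
    (B : RightArc F x' z' r₀ r₁) (h : z t₀ < z' r₀) {s r : ℝ}
    (hs : s ∈ Icc t₀ t₁) (hr : r ∈ Icc r₀ r₁)
    (iA : ∀ t ∈ Ioo s t₁, z t < F (x t)) (iB : ∀ t ∈ Ioo r r₁, z' t < F (x' t))
    (e : x s = x' r) : z' r < z s := by
  have := A.rev.z_lt_of_x_eq (by fun_prop) B.rev (by simpa using A.end_lt hF B h)
    (s := -s) (r := -r) ⟨by linarith [hs.2], by linarith [hs.1]⟩
    ⟨by linarith [hr.2], by linarith [hr.1]⟩
    (fun t ht => neg_lt_neg (iA (-t) ⟨by linarith [ht.2], by linarith [ht.1]⟩))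
    (fun t ht => neg_lt_neg (iB (-t) ⟨by linarith [ht.2], by linarith [ht.1]⟩)) (by simpa)
  simpa using this

/-- The peak is the point of an arc farthest from the `z`-axis. -/
theorem le_peak (A : RightArc F x z t₀ t₁) {p : ℝ} (hp : p ∈ Ioo t₀ t₁)
    (up : ∀ t ∈ Ico t₀ p, F (x t) < z t) (down : ∀ t ∈ Ioc p t₁, z t < F (x t))
    {t : ℝ} (ht : t ∈ Icc t₀ t₁) : x t ≤ x p := by
  rcases le_total t p with h | h
  · exact (A.incOn_x hp.1 fun t ht => up t ⟨ht.1.le, ht.2⟩).strictMonoOn.monotoneOn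
      ⟨ht.1, h⟩ ⟨hp.1.le, le_rfl⟩ h
  · exact neg_le_neg_iff.1 ((A.incOn_neg_x hp.2 fun t ht =>
      down t ⟨ht.1, ht.2.le⟩).strictMonoOn.monotoneOn ⟨le_rfl, hp.2.le⟩ ⟨h, ht.2⟩ h)

/-- An arc that goes beyond the line `x = α` crosses it twice, and stays beyond it in between. -/
theorem exists_cross (hf : ∀ u, HasDerivAt F (f u) u) (hF0 : F 0 = 0) (A : RightArc F x z t₀ t₁)
    {α : ℝ} (hα : 0 < α) (hreach : ∃ t ∈ Icc t₀ t₁, α < x t) :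
    ∃ s s' : ℝ, t₀ < s ∧ s < s' ∧ s' < t₁ ∧ x s = α ∧ x s' = α ∧
      (∀ t ∈ Icc t₀ s, F (x t) < z t) ∧ (∀ t ∈ Icc s' t₁, z t < F (x t)) ∧
      (∀ t ∈ Icc t₀ s, x t ≤ α) ∧ (∀ t ∈ Icc s' t₁, x t ≤ α) ∧
      (∀ t ∈ Icc s s', α ≤ x t) := by
  obtain ⟨p, hp, -, up, down⟩ := A.exists_peak hf hF0
  obtain ⟨t, ht, hαt⟩ := hreach
  have hαp : α < x p := hαt.trans_le (A.le_peak hp up down ht)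
  have iu := (A.incOn_x hp.1 fun t ht => up t ⟨ht.1.le, ht.2⟩).strictMonoOn.monotoneOn
  have id := (A.incOn_neg_x hp.2 fun t ht => down t ⟨ht.1, ht.2.le⟩).strictMonoOn.monotoneOn
  obtain ⟨s, hs, hsα⟩ := intermediate_value_Icc hp.1.le A.contX.continuousOn
    (show α ∈ Icc _ _ from ⟨by rw [A.x₀]; exact hα.le, hαp.le⟩)
  obtain ⟨s', hs', hsα'⟩ := intermediate_value_Icc' hp.2.le A.contX.continuousOn
    (show α ∈ Icc _ _ from ⟨by rw [A.x₁]; exact hα.le, hαp.le⟩)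
  have h₀ : t₀ < s := lt_of_le_of_ne hs.1 (by rintro rfl; linarith [A.x₀])
  have h₁ : s < p := lt_of_le_of_ne hs.2 (by rintro rfl; linarith)
  have h₂ : p < s' := lt_of_le_of_ne hs'.1 (by rintro rfl; linarith)
  have h₃ : s' < t₁ := lt_of_le_of_ne hs'.2 (by rintro rfl; linarith [A.x₁])
  refine ⟨s, s', h₀, h₁.trans h₂, h₃, hsα, hsα', fun t ht => up t ⟨ht.1, ht.2.trans_lt h₁⟩,
    fun t ht => down t ⟨h₂.trans_le ht.1, ht.2⟩,
    fun t ht => hsα ▸ iu ⟨ht.1, ht.2.trans hs.2⟩ hs ht.2,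
    fun t ht => hsα' ▸ neg_le_neg_iff.1 (id hs' ⟨hs'.1.trans ht.1, ht.2⟩ ht.1), fun t ht => ?_⟩
  rcases le_total t p with h | h
  · exact hsα ▸ iu hs ⟨hs.1.trans ht.1, h⟩ ht.1
  · exact hsα' ▸ neg_le_neg_iff.1 (id ⟨h, ht.2.trans hs'.2⟩ hs' ht.2)

section Reach

variable {α : ℝ}

/-- An arc that stays in a strip where `F < 0` gains energy. -/
theorem gain_of_le (A : RightArc F x z t₀ t₁) (hα : 0 < α) (hF0 : F 0 = 0) (hFα : F α = 0)
    (hneg : ∀ u ∈ Ioo 0 α, F u < 0) (hle : ∀ t ∈ Icc t₀ t₁, x t ≤ α) :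
    z t₀ < -z t₁ ∧ z t₀ < α := by
  have hnp : ∀ t ∈ Icc t₀ t₁, F (x t) ≤ 0 := by
    intro t ht
    rcases (A.nonneg ht).eq_or_lt with h | h
    · rw [← h, hF0]
    rcases (hle t ht).eq_or_lt with h' | h'
    · rw [h', hFα]
    exact (hneg _ ⟨h, h'⟩).le
  have key : ∀ s ∈ Ioc t₀ t₁, x t₀ ^ 2 + z t₀ ^ 2 < x s ^ 2 + z s ^ 2 := by
    intro s hs
    obtain ⟨c, hc, hcα⟩ := A.exists_small hα hs.1
    have hxc := A.pos c ⟨hc.1, hc.2.trans_le hs.2⟩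
    refine lt_of_deriv_nonneg_of_pos A.deriv_sq (fun t ht => ?_) hc ?_
    · have h := hnp t ⟨ht.1.le, ht.2.le.trans hs.2⟩
      have h' := A.nonneg ⟨ht.1.le, ht.2.le.trans hs.2⟩
      nlinarith [mul_nonneg h' (neg_nonneg.2 h)]
    · have h := hneg _ ⟨hxc, hcα⟩
      nlinarith [mul_pos hxc (neg_pos.2 h)]
  have z₀ := A.z₀
  have z₁ := A.z₁
  constructor
  · have := key t₁ ⟨A.lt, le_rfl⟩
    rw [A.x₀, A.x₁] at this
    nlinarith
  · obtain ⟨s, hs, hs0⟩ := A.exists_z_eq (c := 0) ⟨z₁.le, z₀.le⟩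
    have := key s ⟨lt_of_le_of_ne hs.1 (by rintro rfl; linarith), hs.2⟩
    rw [A.x₀, hs0] at this
    nlinarith [hle s hs, A.nonneg hs]

/-- An arc that leaves a strip where `F < 0` ends outside of the disc spanned by the strip. -/
theorem le_end_of_reach (hf : ∀ u, HasDerivAt F (f u) u) (A : RightArc F x z t₀ t₁) (hα : 0 < α)
    (hF0 : F 0 = 0) (hneg : ∀ u ∈ Ioo 0 α, F u < 0) (hFα : F α = 0)
    (hreach : ∃ t ∈ Icc t₀ t₁, α < x t) : α ≤ -z t₁ := by
  obtain ⟨s, s', h₀, h₁, h₂, -, e, -, -, -, hle, -⟩ := A.exists_cross hf hF0 hα hreach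
  have := le_of_deriv_nonneg A.deriv_sq h₂.le fun t ht => by
    have hm : t ∈ Ioo t₀ t₁ := ⟨by linarith [ht.1], ht.2⟩
    have hx := A.pos t hm
    have : F (x t) ≤ 0 := by
      rcases (hle t ⟨ht.1.le, ht.2.le⟩).eq_or_lt with h | h
      · rw [h, hFα]
      · exact (hneg _ ⟨hx, h⟩).le
    nlinarith [mul_nonneg hx.le (neg_nonneg.2 this)]
  rw [e, A.x₁] at this
  nlinarith [sq_nonneg (z s'), A.z₁]

/-- An arc that stays in a strip where `f < 0` gains energy. -/
theorem gain_of_le' (hf : ∀ u, HasDerivAt F (f u) u) (A : RightArc F x z t₀ t₁) (hα : 0 < α)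
    (hF0 : F 0 = 0) (hneg : ∀ u ∈ Ioo 0 α, f u < 0) (hfα : f α = 0)
    (hle : ∀ t ∈ Icc t₀ t₁, x t ≤ α) :
    z t₀ < -z t₁ ∧ z t₀ < α := by
  obtain ⟨p, hp, ep, up, -⟩ := A.exists_peak hf hF0
  have key : ∀ s ∈ Icc p t₁,
      x t₀ ^ 2 + (z t₀ - F (x t₀)) ^ 2 < x s ^ 2 + (z s - F (x s)) ^ 2 := by
    intro s hs
    obtain ⟨c, hc, hcα⟩ := A.exists_small hα hp.1
    refine lt_of_deriv_nonneg_of_pos (A.deriv_sq_y hf) (fun t ht => ?_)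
      (c := c) ⟨hc.1, hc.2.trans_le hs.1⟩ ?_
    · have hm : t ∈ Ioo t₀ t₁ := ⟨ht.1, ht.2.trans_le hs.2⟩
      have : f (x t) ≤ 0 := by
        rcases (hle t ⟨hm.1.le, hm.2.le⟩).eq_or_lt with h | h
        · rw [h, hfα]
        · exact (hneg _ ⟨A.pos t hm, h⟩).le
      nlinarith [mul_nonneg (neg_nonneg.2 this) (sq_nonneg (z t - F (x t)))]
    · have h := hneg _ ⟨A.pos c ⟨hc.1, hc.2.trans hp.2⟩, hcα⟩
      have h' := sub_pos.2 (up c ⟨hc.1.le, hc.2⟩)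
      nlinarith [mul_pos (neg_pos.2 h) (pow_pos h' 2)]
  have z₀ := A.z₀
  have z₁ := A.z₁
  constructor
  · have := key t₁ ⟨hp.2.le, le_rfl⟩
    rw [A.x₀, A.x₁, hF0] at this
    nlinarith
  · have := key p ⟨le_rfl, hp.2.le⟩
    rw [A.x₀, ep, hF0] at this
    have hm : p ∈ Icc t₀ t₁ := ⟨hp.1.le, hp.2.le⟩
    nlinarith [hle p hm, A.nonneg hm]

/-- An arc that leaves a strip where `f < 0` ends outside of the disc spanned by the strip. -/
theorem lt_end_of_reach (hf : ∀ u, HasDerivAt F (f u) u) (A : RightArc F x z t₀ t₁) (hα : 0 < α)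
    (hF0 : F 0 = 0) (hneg : ∀ u ∈ Ioo 0 α, f u < 0) (hfα : f α = 0)
    (hreach : ∃ t ∈ Icc t₀ t₁, α < x t) : α < -z t₁ := by
  obtain ⟨s, s', h₀, h₁, h₂, -, e, -, down, -, hle, -⟩ := A.exists_cross hf hF0 hα hreach
  have := le_of_deriv_nonneg (A.deriv_sq_y hf) h₂.le fun t ht => by
    have hm : t ∈ Ioo t₀ t₁ := ⟨by linarith [ht.1], ht.2⟩
    have : f (x t) ≤ 0 := by
      rcases (hle t ⟨ht.1.le, ht.2.le⟩).eq_or_lt with h | h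
      · rw [h, hfα]
      · exact (hneg _ ⟨A.pos t hm, h⟩).le
    nlinarith [mul_nonneg (neg_nonneg.2 this) (sq_nonneg (z t - F (x t)))]
  have hy := sub_neg.2 (down s' ⟨le_rfl, h₂.le⟩)
  have := pow_pos (neg_pos.2 hy) 2
  rw [e, A.x₁, hF0] at *
  nlinarith [A.z₁]

end Reach

end RightArc

namespace RightArc

variable {F f x z x' z' : ℝ → ℝ} {t₀ t₁ r₀ r₁ : ℝ}

/-- While crossing a strip upwards where `c F < 0`, the outer arc changes its energy less. -/
theorem strip_lt (hF : ContDiff ℝ 1 F) (A : RightArc F x z t₀ t₁)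
    (B : RightArc F x' z' r₀ r₁) (h : z t₀ < z' r₀) {α c : ℝ} (hFα : F α = 0)
    (hneg : ∀ u ∈ Ioo 0 α, c * F u < 0) {G g : ℝ → ℝ} (hG : ∀ u, 0 < u → HasDerivAt G (g u) u)
    (hg : ∀ u, 0 < u → 0 < g u) (hga : AntitoneOn g (Ioi 0)) {s r : ℝ}
    (hs : s ∈ Ioo t₀ t₁) (hr : r ∈ Ioo r₀ r₁) (es : x s = α) (er : x' r = α)
    (iA : ∀ t ∈ Icc t₀ s, F (x t) < z t) (iB : ∀ t ∈ Icc r₀ r, F (x' t) < z' t) :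
    c * (G (x' r ^ 2 + z' r ^ 2) - G (x' r₀ ^ 2 + z' r₀ ^ 2)) <
      c * (G (x s ^ 2 + z s ^ 2) - G (x t₀ ^ 2 + z t₀ ^ 2)) := by
  have uA := A.incOn_x hs.1 fun t ht => iA t (Ioo_subset_Icc_self ht)
  have uB := B.incOn_x hr.1 fun t ht => iB t (Ioo_subset_Icc_self ht)
  have zA : ∀ t ∈ Icc t₀ s, 0 < z t := by
    intro t ht
    have h₁ := iA s ⟨hs.1.le, le_rfl⟩
    rw [es, hFα] at h₁
    rcases ht.2.eq_or_lt with rfl | h₂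
    · exact h₁
    · exact h₁.trans (A.z_lt ⟨ht.1, ht.2.trans hs.2.le⟩ ⟨hs.1.le, hs.2.le⟩ h₂)
  have zB : ∀ t ∈ Icc r₀ r, 0 < z' t := by
    intro t ht
    have h₁ := iB r ⟨hr.1.le, le_rfl⟩
    rw [er, hFα] at h₁
    rcases ht.2.eq_or_lt with rfl | h₂
    · exact h₁
    · exact h₁.trans (B.z_lt ⟨ht.1, ht.2.trans hr.2.le⟩ ⟨hr.1.le, hr.2.le⟩ h₂)
  have eA : ∀ t ∈ Icc t₀ s, 0 < x t ^ 2 + z t ^ 2 := fun t ht => by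
    have := zA t ht; positivity
  have eB : ∀ t ∈ Icc r₀ r, 0 < x' t ^ 2 + z' t ^ 2 := fun t ht => by
    have := zB t ht; positivity
  have dA : ∀ t ∈ Icc t₀ s, HasDerivAt (fun t => c * G (x t ^ 2 + z t ^ 2))
      (c * (g (x t ^ 2 + z t ^ 2) * (2 * (-(x t * F (x t)))))) t := fun t ht =>
    (((hG _ (eA t ht)).comp t (A.deriv_sq t))).const_mul c
  have dB : ∀ t ∈ Icc r₀ r, HasDerivAt (fun t => c * G (x' t ^ 2 + z' t ^ 2))
      (c * (g (x' t ^ 2 + z' t ^ 2) * (2 * (-(x' t * F (x' t)))))) t := fun t ht =>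
    (((hG _ (eB t ht)).comp t (B.deriv_sq t))).const_mul c
  have key : ∀ a ∈ Ioo t₀ s, ∀ b ∈ Ioo r₀ r, x a = x' b →
      c * (g (x' b ^ 2 + z' b ^ 2) * (2 * (-(x' b * F (x' b))))) / (z' b - F (x' b)) <
      c * (g (x a ^ 2 + z a ^ 2) * (2 * (-(x a * F (x a))))) / (z a - F (x a)) := by
    intro a ha b hb hab
    have ha' := Ioo_subset_Icc_self ha
    have hb' := Ioo_subset_Icc_self hb
    have hz := A.z_lt_of_x_eq hF B h ⟨ha.1.le, (ha.2.trans hs.2).le⟩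
      ⟨hb.1.le, (hb.2.trans hr.2).le⟩ (fun t ht => iA t ⟨ht.1.le, (ht.2.trans ha.2).le⟩)
      (fun t ht => iB t ⟨ht.1.le, (ht.2.trans hb.2).le⟩) hab
    have hx : x a < α := es ▸ uA.strictMonoOn ha' ⟨hs.1.le, le_rfl⟩ ha.2
    have hx0 := A.pos a ⟨ha.1, ha.2.trans hs.2⟩
    have hn := hneg _ ⟨hx0, hx⟩
    have yA := sub_pos.2 (iA a ha')
    have h₁ := eA a ha'
    have h₂ := eB b hb'
    have hz0 := zA a ha'
    rw [← hab] at h₂ ⊢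
    have hlt : x a ^ 2 + z a ^ 2 ≤ x a ^ 2 + z' b ^ 2 := by nlinarith
    have hg' := hga h₁ h₂ hlt
    have p₁ := hg _ h₂
    have p₂ := hg _ h₁
    have hK : 0 < 2 * x a * (-(c * F (x a))) := by
      have := neg_pos.2 hn
      positivity
    calc c * (g (x a ^ 2 + z' b ^ 2) * (2 * (-(x a * F (x a))))) / (z' b - F (x a))
        = (2 * x a * (-(c * F (x a)))) * g (x a ^ 2 + z' b ^ 2) / (z' b - F (x a)) := by ring
      _ < (2 * x a * (-(c * F (x a)))) * g (x a ^ 2 + z' b ^ 2) / (z a - F (x a)) := by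
          apply div_lt_div_of_pos_left _ yA (by linarith)
          positivity
      _ ≤ (2 * x a * (-(c * F (x a)))) * g (x a ^ 2 + z a ^ 2) / (z a - F (x a)) := by
          gcongr
      _ = _ := by ring
  have := (uA.sub_le_sub_of_rate_le (e₁ := fun t => c * G (x t ^ 2 + z t ^ 2))
    (e₂ := fun t => c * G (x' t ^ 2 + z' t ^ 2))
    (ρ₁ := fun t => c * (g (x t ^ 2 + z t ^ 2) * (2 * (-(x t * F (x t))))) / (z t - F (x t)))
    (ρ₂ := fun t => c * (g (x' t ^ 2 + z' t ^ 2) * (2 * (-(x' t * F (x' t))))) / (z' t - F (x' t)))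
    uB (by rw [A.x₀, B.x₀]) (by rw [es, er])
    (HasDerivAt.continuousOn fun t ht => dA t ht) (HasDerivAt.continuousOn fun t ht => dB t ht)
    (fun t ht => (dA t (Ioo_subset_Icc_self ht)).congr_deriv
      (div_mul_cancel₀ _ (uA.pos t ht).ne').symm)
    (fun t ht => (dB t (Ioo_subset_Icc_self ht)).congr_deriv
      (div_mul_cancel₀ _ (uB.pos t ht).ne').symm)
    (fun a ha b hb hab => (key a ha b hb hab).le)).2
    ⟨(t₀ + s) / 2, ⟨by linarith [hs.1], by linarith [hs.1]⟩, fun b hb hab =>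
      key _ ⟨by linarith [hs.1], by linarith [hs.1]⟩ b hb hab⟩
  simp only [← mul_sub] at this
  exact this

/-- While crossing a strip downwards where `F < 0`, the outer arc gains less energy. -/
theorem strip_lt' (hF : ContDiff ℝ 1 F) (A : RightArc F x z t₀ t₁)
    (B : RightArc F x' z' r₀ r₁) (h : z t₀ < z' r₀) {α : ℝ} (hFα : F α = 0)
    (hneg : ∀ u ∈ Ioo 0 α, F u < 0) {G g : ℝ → ℝ} (hG : ∀ u, 0 < u → HasDerivAt G (g u) u)
    (hg : ∀ u, 0 < u → 0 < g u) (hga : AntitoneOn g (Ioi 0)) {s r : ℝ}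
    (hs : s ∈ Ioo t₀ t₁) (hr : r ∈ Ioo r₀ r₁) (es : x s = α) (er : x' r = α)
    (iA : ∀ t ∈ Icc s t₁, z t < F (x t)) (iB : ∀ t ∈ Icc r r₁, z' t < F (x' t)) :
    G (x' r₁ ^ 2 + z' r₁ ^ 2) - G (x' r ^ 2 + z' r ^ 2) <
      G (x t₁ ^ 2 + z t₁ ^ 2) - G (x s ^ 2 + z s ^ 2) := by
  have := A.rev.strip_lt (by fun_prop) B.rev (by simpa using A.end_lt hF B h) (α := α) (c := -1)
    (by simpa using hFα) (by simpa using hneg) hG hg hga (s := -s) (r := -r)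
    ⟨by linarith [hs.2], by linarith [hs.1]⟩ ⟨by linarith [hr.2], by linarith [hr.1]⟩
    (by simpa) (by simpa)
    (fun t ht => neg_lt_neg (iA (-t) ⟨by linarith [ht.2], by linarith [ht.1]⟩))
    (fun t ht => neg_lt_neg (iB (-t) ⟨by linarith [ht.2], by linarith [ht.1]⟩))
  simp only [neg_neg, neg_sq] at this
  linarith

theorem _root_.IsSol.sq_le_sq_of_nonneg (h : IsSol F x z) {a b : ℝ} (hab : a ≤ b)
    (hnn : ∀ t ∈ Ioo a b, 0 ≤ x t * F (x t)) : x b ^ 2 + z b ^ 2 ≤ x a ^ 2 + z a ^ 2 := by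
  have := le_of_deriv_nonneg (fun t => (h.deriv_sq t).neg) hab fun t ht => by
    linarith [hnn t ht]
  simp only [Pi.neg_apply] at this
  linarith

/-- Beyond a strip where `F < 0`, with `F` increasing, the outer arc gains less energy. -/
theorem sq_sub_sq_lt (hf : ∀ u, HasDerivAt F (f u) u) (hF : ContDiff ℝ 1 F)
    (A : RightArc F x z t₀ t₁) (B : RightArc F x' z' r₀ r₁) (h : z t₀ < z' r₀) {α : ℝ}
    (hα : 0 < α) (hF0 : F 0 = 0) (hFα : F α = 0) (hneg : ∀ u ∈ Ioo 0 α, F u < 0)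
    (hmono : MonotoneOn F (Ici α)) (hA : ∃ t ∈ Icc t₀ t₁, α < x t)
    (hB : ∃ t ∈ Icc r₀ r₁, α < x' t) :
    z' r₁ ^ 2 - z' r₀ ^ 2 < z t₁ ^ 2 - z t₀ ^ 2 := by
  obtain ⟨s, s', hs, hss, hs', es, es', upA, downA, -, -, leA⟩ := A.exists_cross hf hF0 hα hA
  obtain ⟨r, r', hr, hrr, hr', er, er', upB, downB, -, -, leB⟩ := B.exists_cross hf hF0 hα hB
  have ms : s ∈ Ioo t₀ t₁ := ⟨hs, hss.trans hs'⟩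
  have ms' : s' ∈ Ioo t₀ t₁ := ⟨hs.trans hss, hs'⟩
  have mr : r ∈ Ioo r₀ r₁ := ⟨hr, hrr.trans hr'⟩
  have mr' : r' ∈ Ioo r₀ r₁ := ⟨hr.trans hrr, hr'⟩
  have top := A.strip_lt hF B h (c := 1) hFα (by simpa using hneg) (G := id) (g := fun _ => 1)
    (fun u _ => hasDerivAt_id u) (fun _ _ => one_pos) antitoneOn_const ms mr es er upA upB
  have bot := A.strip_lt' hF B h hFα hneg (G := id) (g := fun _ => 1)
    (fun u _ => hasDerivAt_id u) (fun _ _ => one_pos) antitoneOn_const ms' mr' es' er' downA downB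
  have zr : z s < z' r := A.z_lt_of_x_eq hF B h (Ioo_subset_Icc_self ms) (Ioo_subset_Icc_self mr)
    (fun t ht => upA t (Ioo_subset_Icc_self ht)) (fun t ht => upB t (Ioo_subset_Icc_self ht))
    (by rw [es, er])
  have zr' : z' r' < z s' := A.z_lt_of_x_eq' hF B h (Ioo_subset_Icc_self ms')
    (Ioo_subset_Icc_self mr') (fun t ht => downA t (Ioo_subset_Icc_self ht))
    (fun t ht => downB t (Ioo_subset_Icc_self ht)) (by rw [es', er'])
  have zss := A.z_lt (Ioo_subset_Icc_self ms) (Ioo_subset_Icc_self ms') hss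
  have cz : ContinuousOn z' (Icc r r') := B.contZ.continuousOn
  obtain ⟨p, hp, ep⟩ := intermediate_value_Icc' hrr.le cz
    (show z s ∈ Icc _ _ from ⟨by linarith, zr.le⟩)
  obtain ⟨q, hq, eq⟩ := intermediate_value_Icc' hrr.le cz
    (show z s' ∈ Icc _ _ from ⟨zr'.le, by linarith⟩)
  have mp : p ∈ Icc r₀ r₁ := ⟨hr.le.trans hp.1, hp.2.trans hr'.le⟩
  have mq : q ∈ Icc r₀ r₁ := ⟨hr.le.trans hq.1, hq.2.trans hr'.le⟩
  have hpq : p < q := by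
    by_contra hcon
    rcases (not_lt.1 hcon).eq_or_lt with e | l
    · rw [e] at eq; linarith
    · have := B.z_lt mq mp l; linarith
  have nnB : ∀ t ∈ Icc r r', 0 ≤ F (x' t) := fun t ht =>
    hFα ▸ hmono self_mem_Ici (leB t ht) (leB t ht)
  have anti : ∀ a b : ℝ, r ≤ a → a ≤ b → b ≤ r' →
      x' b ^ 2 + z' b ^ 2 ≤ x' a ^ 2 + z' a ^ 2 := fun a b ha hab hb =>
    B.sq_le_sq_of_nonneg hab fun t ht => by
      have hm : t ∈ Icc r r' := ⟨by linarith [ht.1], by linarith [ht.2]⟩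
      exact mul_nonneg (hα.le.trans (leB t hm)) (nnB t hm)
  have mid := ((A.incOn_neg_z.mono hss hs.le hs'.le).sub_le_sub_of_rate_le
    (B.incOn_neg_z.mono hpq mp.1 mq.2) (by simp [ep]) (by simp [eq])
    (e₁ := fun t => x t ^ 2 + z t ^ 2) (e₂ := fun t => x' t ^ 2 + z' t ^ 2)
    (ρ₁ := fun t => -2 * F (x t)) (ρ₂ := fun t => -2 * F (x' t))
    (HasDerivAt.continuousOn fun t _ => A.deriv_sq t)
    (HasDerivAt.continuousOn fun t _ => B.deriv_sq t)
    (fun t _ => (A.deriv_sq t).congr_deriv (by ring))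
    (fun t _ => (B.deriv_sq t).congr_deriv (by ring)) (fun a ha b hb hab => by
      have := A.x_lt_of_z_eq hF B h (s := a) (r := b)
        ⟨(hs.trans ha.1).le, (ha.2.trans hs').le⟩
        ⟨mp.1.trans hb.1.le, hb.2.le.trans mq.2⟩ (neg_injective hab)
      have h₁ := leA a (Ioo_subset_Icc_self ha)
      have := hmono h₁ (h₁.trans this.le) this.le
      linarith)).1
  have l₁ := anti r p le_rfl hp.1 hp.2
  have l₂ := anti q r' hq.1 hq.2 le_rfl
  simp only [A.x₀, A.x₁, B.x₀, B.x₁, id] at top bot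
  linarith

end RightArc

/-- Points of the right half-plane on the same ray are proportional. -/
theorem eq_mul_of_ray_eq {X Z X' Z' : ℝ} (hE : 0 < X ^ 2 + Z ^ 2) (hE' : 0 < X' ^ 2 + Z' ^ 2)
    (hX : 0 ≤ X) (hX' : 0 ≤ X') (h : -Z / √(X ^ 2 + Z ^ 2) = -Z' / √(X' ^ 2 + Z' ^ 2)) :
    X' = √(X' ^ 2 + Z' ^ 2) / √(X ^ 2 + Z ^ 2) * X ∧
      Z' = √(X' ^ 2 + Z' ^ 2) / √(X ^ 2 + Z ^ 2) * Z := by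
  have h₁ := Real.sqrt_pos.2 hE
  have h₂ := Real.sqrt_pos.2 hE'
  have q₁ := Real.sq_sqrt hE.le
  have q₂ := Real.sq_sqrt hE'.le
  generalize √(X ^ 2 + Z ^ 2) = R at *
  generalize √(X' ^ 2 + Z' ^ 2) = S at *
  have hz : Z' = S / R * Z := by
    field_simp at h ⊢
    linarith
  refine ⟨?_, hz⟩
  have hS : S = S / R * R := by field_simp
  have hk : 0 < S / R := div_pos h₂ h₁
  generalize S / R = k at *
  rw [← sq_eq_sq₀ hX' (by positivity)]
  rw [hz, hS] at q₂
  linear_combination k ^ 2 * q₁ - q₂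

theorem ray_lt {α Z Z' : ℝ} (hα : 0 < α) (hZ : 0 < Z) (h : Z < Z') :
    Z / √(α ^ 2 + Z ^ 2) < Z' / √(α ^ 2 + Z' ^ 2) := by
  rw [div_lt_div_iff₀ (by positivity) (by positivity),
    ← sq_lt_sq₀ (by positivity) (by have := hZ.trans h; positivity), mul_pow, mul_pow,
    Real.sq_sqrt (by positivity), Real.sq_sqrt (by positivity)]
  have : Z ^ 2 < Z' ^ 2 := by gcongr
  nlinarith [mul_pos (pow_pos hα 2) (sub_pos.2 this)]

namespace RightArc

variable {F f x z x' z' : ℝ → ℝ} {t₀ t₁ r₀ r₁ : ℝ}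

theorem sq_pos (A : RightArc F x z t₀ t₁) {t : ℝ} (ht : t ∈ Icc t₀ t₁) :
    0 < x t ^ 2 + z t ^ 2 := by
  rcases ht.1.eq_or_lt with rfl | h
  · have := A.z₀; positivity
  rcases ht.2.eq_or_lt with rfl | h'
  · have := A.z₁.ne; positivity
  · have := A.pos t ⟨h, h'⟩; positivity

/-- The direction of the position vector rotates clockwise where `x² + z (z - F x) > 0`. -/
theorem incOn_ray (A : RightArc F x z t₀ t₁) {s s' : ℝ} (hlt : s < s') (h₀ : t₀ ≤ s) (h₁ : s' ≤ t₁)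
    (hN : ∀ t ∈ Ioo s s', 0 < x t ^ 2 + z t * (z t - F (x t))) :
    IncOn (fun t => -z t / √(x t ^ 2 + z t ^ 2))
      (fun t => x t * (x t ^ 2 + z t * (z t - F (x t))) / √(x t ^ 2 + z t ^ 2) ^ 3) s s' where
  lt := hlt
  cont := by
    have hx := A.contX
    have hz := A.contZ
    refine ContinuousOn.div (by fun_prop) (by fun_prop) fun t ht => ?_
    exact (Real.sqrt_pos.2 (A.sq_pos ⟨h₀.trans ht.1, ht.2.trans h₁⟩)).ne'
  deriv t ht := by
    have hE := A.sq_pos ⟨h₀.trans ht.1.le, ht.2.le.trans h₁⟩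
    have hR := Real.sqrt_pos.2 hE
    have hR2 := Real.sq_sqrt hE.le
    refine (((A.hz t).neg).div ((A.deriv_sq t).sqrt hE.ne') hR.ne').congr_deriv ?_
    simp only [Pi.neg_apply]
    generalize √(x t ^ 2 + z t ^ 2) = R at *
    field_simp
    rw [hR2]
    ring
  pos t ht := by
    have hE := A.sq_pos ⟨h₀.trans ht.1.le, ht.2.le.trans h₁⟩
    have := Real.sqrt_pos.2 hE
    have := A.pos t ⟨h₀.trans_lt ht.1, ht.2.trans_le h₁⟩
    have := hN t ht
    positivity

/-- Between two common rays, if `F(u) / u` increases, the outer arc gains less energy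
in the logarithmic scale. -/
theorem log_sub_log_le (hF : ContDiff ℝ 1 F)
    (A : RightArc F x z t₀ t₁) (B : RightArc F x' z' r₀ r₁) (h : z t₀ < z' r₀) {s s' r r' : ℝ}
    (hs : s < s') (hs₀ : t₀ ≤ s) (hs₁ : s' ≤ t₁) (hr : r < r') (hr₀ : r₀ ≤ r) (hr₁ : r' ≤ r₁)
    (hNA : ∀ t ∈ Ioo s s', 0 < x t ^ 2 + z t * (z t - F (x t)))
    (hNB : ∀ t ∈ Ioo r r', 0 < x' t ^ 2 + z' t * (z' t - F (x' t)))
    (hl : -z s / √(x s ^ 2 + z s ^ 2) = -z' r / √(x' r ^ 2 + z' r ^ 2))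
    (hr' : -z s' / √(x s' ^ 2 + z s' ^ 2) = -z' r' / √(x' r' ^ 2 + z' r' ^ 2))
    (hlt : x s ^ 2 + z s ^ 2 < x' r ^ 2 + z' r ^ 2)
    (hφ : ∀ a ∈ Ioo s s', ∀ b ∈ Ioo r r', x a < x' b → F (x a) * x' b ≤ F (x' b) * x a) :
    Real.log (x' r' ^ 2 + z' r' ^ 2) - Real.log (x' r ^ 2 + z' r ^ 2) ≤
      Real.log (x s' ^ 2 + z s' ^ 2) - Real.log (x s ^ 2 + z s ^ 2) ∧
    ((∃ b ∈ Ioo r r', ∀ a ∈ Ioo s s', x a < x' b → F (x a) * x' b < F (x' b) * x a) →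
      Real.log (x' r' ^ 2 + z' r' ^ 2) - Real.log (x' r ^ 2 + z' r ^ 2) <
        Real.log (x s' ^ 2 + z s' ^ 2) - Real.log (x s ^ 2 + z s ^ 2)) := by
  have uA := A.incOn_ray hs hs₀ hs₁ hNA
  have uB := B.incOn_ray hr hr₀ hr₁ hNB
  have EA : ∀ t ∈ Icc s s', 0 < x t ^ 2 + z t ^ 2 := fun t ht =>
    A.sq_pos ⟨hs₀.trans ht.1, ht.2.trans hs₁⟩
  have EB : ∀ t ∈ Icc r r', 0 < x' t ^ 2 + z' t ^ 2 := fun t ht =>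
    B.sq_pos ⟨hr₀.trans ht.1, ht.2.trans hr₁⟩
  have nA : ∀ t ∈ Icc s s', 0 ≤ x t := fun t ht => A.nonneg ⟨hs₀.trans ht.1, ht.2.trans hs₁⟩
  have nB : ∀ t ∈ Icc r r', 0 ≤ x' t := fun t ht => B.nonneg ⟨hr₀.trans ht.1, ht.2.trans hr₁⟩
  have prop : ∀ a ∈ Icc s s', ∀ b ∈ Icc r r',
      -z a / √(x a ^ 2 + z a ^ 2) = -z' b / √(x' b ^ 2 + z' b ^ 2) → _ := fun a ha b hb hab =>
    eq_mul_of_ray_eq (EA a ha) (EB b hb) (nA a ha) (nB b hb) hab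
  have ord := uA.lt_of_ne uB (e₁ := fun t => √(x t ^ 2 + z t ^ 2))
    (e₂ := fun t => √(x' t ^ 2 + z' t ^ 2)) hl hr'
    (by have := A.contX; have := A.contZ; fun_prop)
    (by have := B.contX; have := B.contZ; fun_prop) (fun a ha b hb hab hE => by
      obtain ⟨px, pz⟩ := prop a ha b hb hab
      rw [← hE, div_self (Real.sqrt_pos.2 (EA a ha)).ne', one_mul] at px pz
      exact h.ne (A.start_eq hF B ⟨hs₀.trans ha.1, ha.2.trans hs₁⟩
        ⟨hr₀.trans hb.1, hb.2.trans hr₁⟩ px.symm pz.symm))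
    (a := s) (b := r) ⟨le_rfl, hs.le⟩ ⟨le_rfl, hr.le⟩ hl
    (Real.sqrt_lt_sqrt (EA s ⟨le_rfl, hs.le⟩).le hlt)
  have rate : ∀ a ∈ Ioo s s', ∀ b ∈ Ioo r r',
      -z a / √(x a ^ 2 + z a ^ 2) = -z' b / √(x' b ^ 2 + z' b ^ 2) →
      x a < x' b ∧
      (F (x a) * x' b ≤ F (x' b) * x a →
        -2 * F (x' b) * √(x' b ^ 2 + z' b ^ 2) / (x' b ^ 2 + z' b * (z' b - F (x' b))) ≤
        -2 * F (x a) * √(x a ^ 2 + z a ^ 2) / (x a ^ 2 + z a * (z a - F (x a)))) ∧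
      (F (x a) * x' b < F (x' b) * x a →
        -2 * F (x' b) * √(x' b ^ 2 + z' b ^ 2) / (x' b ^ 2 + z' b * (z' b - F (x' b))) <
        -2 * F (x a) * √(x a ^ 2 + z a ^ 2) / (x a ^ 2 + z a * (z a - F (x a)))) := by
    intro a ha b hb hab
    have ha' := Ioo_subset_Icc_self ha
    have hb' := Ioo_subset_Icc_self hb
    obtain ⟨px, pz⟩ := prop a ha' b hb' hab
    have lt := ord a ha' b hb' hab
    have NA := hNA a ha
    have NB := hNB b hb
    have xa := A.pos a ⟨hs₀.trans_lt ha.1, ha.2.trans_le hs₁⟩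
    have hR := Real.sqrt_pos.2 (EA a ha')
    have q := Real.sq_sqrt (EA a ha').le
    generalize √(x a ^ 2 + z a ^ 2) = R at *
    generalize √(x' b ^ 2 + z' b ^ 2) = S at *
    have hS : S = S / R * R := by field_simp
    have hk : 1 < S / R := (one_lt_div hR).2 lt
    generalize S / R = k at *
    have hk0 : 0 < k := by linarith
    have hxx : x a < x' b := by rw [px]; nlinarith
    have e : (-2 * F (x a) * R) * (x' b ^ 2 + z' b * (z' b - F (x' b))) -
        (-2 * F (x' b) * S) * (x a ^ 2 + z a * (z a - F (x a))) =
        2 * k * R ^ 3 * (F (x' b) - k * F (x a)) := by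
      have alg : ∀ P X Z : ℝ, X = k * x a → Z = k * z a →
          (-2 * F (x a) * R) * (X ^ 2 + Z * (Z - P)) -
          (-2 * P * (k * R)) * (x a ^ 2 + z a * (z a - F (x a))) =
          2 * k * R ^ 3 * (P - k * F (x a)) := by
        rintro P X Z rfl rfl
        linear_combination (-2 * k * R * (P - k * F (x a))) * q
      rw [hS]
      exact alg _ _ _ px pz
    have hkR : 0 < 2 * k * R ^ 3 := by positivity
    refine ⟨hxx, fun hle => ?_, fun hle => ?_⟩
    · rw [div_le_div_iff₀ NB NA]
      have : k * F (x a) ≤ F (x' b) := by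
        nth_rewrite 1 [px] at hle
        exact le_of_mul_le_mul_right (by linarith) xa
      have := mul_nonneg hkR.le (sub_nonneg.2 this)
      rw [← e] at this
      exact sub_nonneg.1 this
    · rw [div_lt_div_iff₀ NB NA]
      have : k * F (x a) < F (x' b) := by
        nth_rewrite 1 [px] at hle
        exact lt_of_mul_lt_mul_right (by linarith) xa.le
      have := mul_pos hkR (sub_pos.2 this)
      rw [← e] at this
      exact sub_pos.1 this
  have dA : ∀ t ∈ Icc s s', HasDerivAt (fun t => Real.log (x t ^ 2 + z t ^ 2)) _ t := fun t ht =>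
    (A.deriv_sq t).log (EA t ht).ne'
  have dB : ∀ t ∈ Icc r r', HasDerivAt (fun t => Real.log (x' t ^ 2 + z' t ^ 2)) _ t := fun t ht =>
    (B.deriv_sq t).log (EB t ht).ne'
  have := uA.sub_le_sub_of_rate_le uB hl hr'
    (ρ₁ := fun a => -2 * F (x a) * √(x a ^ 2 + z a ^ 2) / (x a ^ 2 + z a * (z a - F (x a))))
    (ρ₂ := fun b => -2 * F (x' b) * √(x' b ^ 2 + z' b ^ 2) / (x' b ^ 2 + z' b * (z' b - F (x' b))))
    (HasDerivAt.continuousOn dA) (HasDerivAt.continuousOn dB)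
    (fun t ht => (dA t (Ioo_subset_Icc_self ht)).congr_deriv (by
      have N := (hNA t ht).ne'
      have hE := EA t (Ioo_subset_Icc_self ht)
      have hR := (Real.sqrt_pos.2 hE).ne'
      have q := Real.sq_sqrt hE.le
      nth_rewrite 1 [← q]
      generalize √(x t ^ 2 + z t ^ 2) = R at *
      generalize x t ^ 2 + z t * (z t - F (x t)) = N at *
      field_simp))
    (fun t ht => (dB t (Ioo_subset_Icc_self ht)).congr_deriv (by
      have N := (hNB t ht).ne'
      have hE := EB t (Ioo_subset_Icc_self ht)
      have hR := (Real.sqrt_pos.2 hE).ne'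
      have q := Real.sq_sqrt hE.le
      nth_rewrite 1 [← q]
      generalize √(x' t ^ 2 + z' t ^ 2) = R at *
      generalize x' t ^ 2 + z' t * (z' t - F (x' t)) = N at *
      field_simp))
    (fun a ha b hb hab => by
      obtain ⟨l, l₁, -⟩ := rate a ha b hb hab
      exact l₁ (hφ a ha b hb l))
  refine ⟨this.1, ?_⟩
  rintro ⟨b, hb, hbs⟩
  refine this.2 ?_
  have mB := uB.strictMonoOn
  have mb := Ioo_subset_Icc_self hb
  obtain ⟨a, ha, hab⟩ := intermediate_value_Ioo hs.le uA.cont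
    (show -z' b / √(x' b ^ 2 + z' b ^ 2) ∈ Ioo _ _ from
      ⟨by rw [hl]; exact mB ⟨le_rfl, hr.le⟩ mb hb.1, by rw [hr']; exact mB mb ⟨hr.le, le_rfl⟩ hb.2⟩)
  refine ⟨a, ha, fun b' hb' hab' => ?_⟩
  obtain rfl : b' = b := mB.injOn (Ioo_subset_Icc_self hb') mb (hab'.symm.trans hab)
  obtain ⟨l, -, l₂⟩ := rate a ha b' hb' hab'
  exact l₂ (hbs a ha l)

end RightArc

/-- If `F(u) / u` increases beyond `u`, then `F(u) ≤ u F'(u)`. -/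
theorem le_mul_deriv_of_ratio_mono {F : ℝ → ℝ} {d u : ℝ} (hd : HasDerivAt F d u)
    (h : ∀ v, u < v → F u * v ≤ F v * u) : F u ≤ u * d := by
  by_contra hcon
  push Not at hcon
  have hg : HasDerivAt (fun v => F v * u - F u * v) (d * u - F u) u :=
    ((hd.mul_const u).sub ((hasDerivAt_id u).const_mul (F u))).congr_deriv (by simp)
  obtain ⟨v, hv, hv'⟩ := ((eventually_neg_of_deriv_neg hg (by ring) (by linarith)).and
    self_mem_nhdsWithin).exists
  linarith [h v hv']

/-- The quantity `x² + z (z - F x)` stays positive where `F(x) ≤ x f(x)`. -/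
theorem IsSol.rotation_pos {F f x z : ℝ → ℝ} (hf : ∀ u, HasDerivAt F (f u) u) (cf : Continuous f)
    (h : IsSol F x z) {s s' : ℝ} (h₀ : 0 < x s ^ 2 + z s * (z s - F (x s)))
    (hnn : ∀ t ∈ Ioo s s', 0 ≤ x t * (x t * f (x t) - F (x t))) :
    ∀ t ∈ Ico s s', 0 < x t ^ 2 + z t * (z t - F (x t)) := by
  intro t ht
  have dN : ∀ t, HasDerivAt (fun t => x t ^ 2 + z t * (z t - F (x t)))
      (-(x t * F (x t)) - f (x t) * (z t * (z t - F (x t)))) t := fun t =>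
    (((h.hx t).pow 2).add ((h.hz t).mul (h.deriv_y hf t))).congr_deriv (by norm_num; ring)
  have dI : ∀ t, HasDerivAt (fun t => ∫ τ in s..t, f (x τ)) (f (x t)) t := fun t =>
    (cf.comp h.contX).integral_hasStrictDerivAt s t |>.hasDerivAt
  have := le_of_deriv_nonneg (fun t => (dI t).exp.mul (dN t)) ht.1 fun τ hτ => by
    have h₁ := hnn τ ⟨hτ.1, hτ.2.trans ht.2⟩
    have h₂ := mul_nonneg (Real.exp_pos (∫ τ in s..τ, f (x τ))).le h₁
    linarith
  simp only [Pi.mul_apply, intervalIntegral.integral_same, Real.exp_zero, one_mul] at this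
  exact pos_of_mul_pos_right (h₀.trans_le this) (Real.exp_pos _).le

namespace RightArc

variable {F f x z x' z' : ℝ → ℝ} {t₀ t₁ r₀ r₁ : ℝ}

/-- If `F(u) / u` increases for `u > 0`, the outer arc gains less energy in the logarithmic
scale. -/
theorem log_sub_log_of_ratio_mono (hf : ∀ u, HasDerivAt F (f u) u) (cf : Continuous f)
    (hF : ContDiff ℝ 1 F) (A : RightArc F x z t₀ t₁) (B : RightArc F x' z' r₀ r₁)
    (h : z t₀ < z' r₀) (hF0 : F 0 = 0) (hφ : ∀ u v, 0 < u → u < v → F u * v ≤ F v * u) :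
    Real.log (z' r₁ ^ 2) - Real.log (z' r₀ ^ 2) ≤ Real.log (z t₁ ^ 2) - Real.log (z t₀ ^ 2) ∧
    (∀ m, 0 < m → (∀ u v, 0 < u → u < v → m < v → F u * v < F v * u) →
      (∃ t ∈ Icc r₀ r₁, m < x' t) →
      Real.log (z' r₁ ^ 2) - Real.log (z' r₀ ^ 2) <
        Real.log (z t₁ ^ 2) - Real.log (z t₀ ^ 2)) := by
  have nn : ∀ u, 0 ≤ u → 0 ≤ u * (u * f u - F u) := by
    intro u hu
    rcases hu.eq_or_lt with rfl | hu'
    · simp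
    · exact mul_nonneg hu (sub_nonneg.2 (le_mul_deriv_of_ratio_mono (hf u) fun v => hφ u v hu'))
  have NA := A.rotation_pos hf cf (s := t₀) (s' := t₁)
    (by have := A.z₀; rw [A.x₀, hF0]; nlinarith) fun t ht => nn _ (A.pos t ht).le
  have NB := B.rotation_pos hf cf (s := r₀) (s' := r₁)
    (by have := B.z₀; rw [B.x₀, hF0]; nlinarith) fun t ht => nn _ (B.pos t ht).le
  have key := A.log_sub_log_le hF B h A.lt le_rfl le_rfl B.lt le_rfl le_rfl
    (fun t ht => NA t (Ioo_subset_Ico_self ht)) (fun t ht => NB t (Ioo_subset_Ico_self ht))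
    (by
      simp only [A.x₀, B.x₀, zero_pow two_ne_zero, zero_add, Real.sqrt_sq A.z₀.le,
        Real.sqrt_sq B.z₀.le, neg_div, div_self A.z₀.ne', div_self B.z₀.ne'])
    (by
      simp only [A.x₁, B.x₁, zero_pow two_ne_zero, zero_add, Real.sqrt_sq_eq_abs,
        abs_of_neg A.z₁, abs_of_neg B.z₁, div_self (neg_pos.2 A.z₁).ne',
        div_self (neg_pos.2 B.z₁).ne'])
    (by have := A.z₀; rw [A.x₀, B.x₀]; nlinarith)
    (fun a ha b _ hab => hφ _ _ (A.pos a ha) hab)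
  simp only [A.x₀, A.x₁, B.x₀, B.x₁, zero_pow two_ne_zero, zero_add] at key
  refine ⟨key.1, fun m hm hs ⟨t, ht, hmt⟩ => key.2 ⟨t, ⟨lt_of_le_of_ne ht.1 ?_,
    lt_of_le_of_ne ht.2 ?_⟩, fun a ha hab => hs _ _ (A.pos a ha) hab hmt⟩⟩
  · rintro rfl; linarith [B.x₀]
  · rintro rfl; linarith [B.x₁]

/-- Beyond a strip where `F < 0`, if `F(u) / u` increases beyond the strip, the outer arc gains
less energy in the logarithmic scale. -/
theorem log_sub_log_lt_of_strip (hf : ∀ u, HasDerivAt F (f u) u) (cf : Continuous f)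
    (hF : ContDiff ℝ 1 F) (A : RightArc F x z t₀ t₁) (B : RightArc F x' z' r₀ r₁)
    (h : z t₀ < z' r₀) {α : ℝ} (hα : 0 < α) (hF0 : F 0 = 0) (hFα : F α = 0)
    (hneg : ∀ u ∈ Ioo 0 α, F u < 0) (hφ : ∀ u v, α ≤ u → u < v → F u * v ≤ F v * u)
    (hA : ∃ t ∈ Icc t₀ t₁, α < x t) (hB : ∃ t ∈ Icc r₀ r₁, α < x' t) :
    Real.log (z' r₁ ^ 2) - Real.log (z' r₀ ^ 2) <
      Real.log (z t₁ ^ 2) - Real.log (z t₀ ^ 2) := by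
  obtain ⟨s, s', hs, hss, hs', es, es', upA, downA, -, -, leA⟩ := A.exists_cross hf hF0 hα hA
  obtain ⟨r, r', hr, hrr, hr', er, er', upB, downB, -, -, leB⟩ := B.exists_cross hf hF0 hα hB
  have ms : s ∈ Ioo t₀ t₁ := ⟨hs, hss.trans hs'⟩
  have ms' : s' ∈ Ioo t₀ t₁ := ⟨hs.trans hss, hs'⟩
  have mr : r ∈ Ioo r₀ r₁ := ⟨hr, hrr.trans hr'⟩
  have mr' : r' ∈ Ioo r₀ r₁ := ⟨hr.trans hrr, hr'⟩
  have hg : AntitoneOn (fun u : ℝ => u⁻¹) (Ioi 0) := fun u hu v _ huv => inv_anti₀ hu huv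
  have top := A.strip_lt hF B h (c := 1) hFα (by simpa using hneg)
    (fun u hu => Real.hasDerivAt_log hu.ne') (fun _ => inv_pos.2) hg ms mr es er upA upB
  have bot := A.strip_lt' hF B h hFα hneg (fun u hu => Real.hasDerivAt_log hu.ne')
    (fun _ => inv_pos.2) hg ms' mr' es' er' downA downB
  have zr : z s < z' r := A.z_lt_of_x_eq hF B h (Ioo_subset_Icc_self ms) (Ioo_subset_Icc_self mr)
    (fun t ht => upA t (Ioo_subset_Icc_self ht)) (fun t ht => upB t (Ioo_subset_Icc_self ht))
    (by rw [es, er])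
  have zr' : z' r' < z s' := A.z_lt_of_x_eq' hF B h (Ioo_subset_Icc_self ms')
    (Ioo_subset_Icc_self mr') (fun t ht => downA t (Ioo_subset_Icc_self ht))
    (fun t ht => downB t (Ioo_subset_Icc_self ht)) (by rw [es', er'])
  have zs : 0 < z s := by have := upA s ⟨hs.le, le_rfl⟩; rwa [es, hFα] at this
  have zs' : z s' < 0 := by have := downA s' ⟨le_rfl, hs'.le⟩; rwa [es', hFα] at this
  have nn : ∀ u, α ≤ u → 0 ≤ F u := by
    intro u hu
    rcases hu.eq_or_lt with rfl | hu'
    · exact hFα.ge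
    · have := hφ α u le_rfl hu'
      rw [hFα, zero_mul] at this
      exact nonneg_of_mul_nonneg_left this hα
  have nn' : ∀ u, α ≤ u → 0 ≤ u * (u * f u - F u) := fun u hu =>
    mul_nonneg (hα.le.trans hu) (sub_nonneg.2
      (le_mul_deriv_of_ratio_mono (hf u) fun v => hφ u v hu))
  have NA := A.rotation_pos hf cf (s := s) (s' := s')
    (by rw [es, hFα]; nlinarith) fun t ht => nn' _ (leA t (Ioo_subset_Icc_self ht))
  have NB := B.rotation_pos hf cf (s := r) (s' := r')
    (by rw [er, hFα]; nlinarith) fun t ht => nn' _ (leB t (Ioo_subset_Icc_self ht))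
  have uA := A.incOn_ray hss hs.le hs'.le fun t ht => NA t (Ioo_subset_Ico_self ht)
  have uB := B.incOn_ray hrr hr.le hr'.le fun t ht => NB t (Ioo_subset_Ico_self ht)
  have hrs : -z' r / √(x' r ^ 2 + z' r ^ 2) < -z s / √(x s ^ 2 + z s ^ 2) := by
    rw [es, er, neg_div, neg_div]
    exact neg_lt_neg (ray_lt hα zs zr)
  have hrs' : -z s' / √(x s' ^ 2 + z s' ^ 2) < -z' r' / √(x' r' ^ 2 + z' r' ^ 2) := by
    have := ray_lt hα (neg_pos.2 zs') (neg_lt_neg zr')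
    rw [neg_sq, neg_sq] at this
    rwa [es', er']
  have lss := uA.strictMonoOn ⟨le_rfl, hss.le⟩ ⟨hss.le, le_rfl⟩ hss
  obtain ⟨p, hp, ep⟩ := intermediate_value_Icc hrr.le uB.cont
    (show -z s / √(x s ^ 2 + z s ^ 2) ∈ Icc _ _ from ⟨hrs.le, (lss.trans hrs').le⟩)
  obtain ⟨q, hq, eq⟩ := intermediate_value_Icc hrr.le uB.cont
    (show -z s' / √(x s' ^ 2 + z s' ^ 2) ∈ Icc _ _ from ⟨(hrs.trans lss).le, hrs'.le⟩)
  have hpq : p < q := by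
    rw [← uB.strictMonoOn.lt_iff_lt hp hq]
    simp only at ep eq lss ⊢
    rw [ep, eq]
    exact lss
  have mp : p ∈ Icc r₀ r₁ := ⟨hr.le.trans hp.1, hp.2.trans hr'.le⟩
  have hEs := A.sq_pos (Ioo_subset_Icc_self ms)
  have hEp := B.sq_pos mp
  have hlt : x s ^ 2 + z s ^ 2 < x' p ^ 2 + z' p ^ 2 := by
    obtain ⟨px, pz⟩ := eq_mul_of_ray_eq hEs hEp (by rw [es]; exact hα.le) (B.nonneg mp) ep.symm
    have hle := leB p hp
    by_contra hcon
    rcases (not_lt.1 hcon).eq_or_lt with e | l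
    · rw [e, div_self (Real.sqrt_pos.2 hEs).ne', one_mul] at px pz
      exact h.ne (A.start_eq hF B (Ioo_subset_Icc_self ms) mp px.symm pz.symm)
    · have := (div_lt_one (Real.sqrt_pos.2 hEs)).2 (Real.sqrt_lt_sqrt hEp.le l)
      rw [px, es] at hle
      rw [es] at this
      have := mul_lt_mul_of_pos_right this hα
      linarith
  have mid := (A.log_sub_log_le hF B h hss hs.le hs'.le hpq mp.1 (hq.2.trans hr'.le)
    (fun t ht => NA t (Ioo_subset_Ico_self ht))
    (fun t ht => NB t ⟨hp.1.trans ht.1.le, ht.2.trans_le hq.2⟩) ep.symm eq.symm hlt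
    (fun a ha b _ hab => hφ _ _ (leA a (Ioo_subset_Icc_self ha)) hab)).1
  have anti : ∀ a b : ℝ, r ≤ a → a ≤ b → b ≤ r' →
      Real.log (x' b ^ 2 + z' b ^ 2) ≤ Real.log (x' a ^ 2 + z' a ^ 2) := fun a b ha hab hb =>
    Real.log_le_log (B.sq_pos ⟨(hr.le.trans ha).trans hab, hb.trans hr'.le⟩) <|
      B.sq_le_sq_of_nonneg hab fun t ht => by
        have := leB t ⟨by linarith [ht.1], by linarith [ht.2]⟩
        exact mul_nonneg (hα.le.trans this) (nn _ this)
  have l₁ := anti r p le_rfl hp.1 hp.2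
  have l₂ := anti q r' hq.1 hq.2 le_rfl
  simp only [A.x₀, A.x₁, B.x₀, B.x₁, zero_pow two_ne_zero, zero_add, one_mul] at top bot
  linarith

end RightArc

theorem div_sqrt_lt {k y y' : ℝ} (hy : 0 < y) (hyy : y < y') (hk : 0 < k) (h : 0 < y ^ 2 - k) :
    y' / √(y' ^ 2 - k) < y / √(y ^ 2 - k) := by
  have hsq : y ^ 2 < y' ^ 2 := by gcongr
  have h' : 0 < y' ^ 2 - k := by linarith
  rw [div_lt_div_iff₀ (Real.sqrt_pos.2 h') (Real.sqrt_pos.2 h),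
    ← sq_lt_sq₀ (by have := hy.trans hyy; positivity) (by positivity), mul_pow, mul_pow,
    Real.sq_sqrt h.le, Real.sq_sqrt h'.le]
  nlinarith [mul_pos hk (sub_pos.2 hsq)]

theorem div_sqrt_le {k y y' : ℝ} (hy : 0 < y) (hyy : y < y') (hk : k ≤ 0) :
    y / √(y ^ 2 - k) ≤ y' / √(y' ^ 2 - k) := by
  have hsq : y ^ 2 < y' ^ 2 := by gcongr
  have h : 0 < y ^ 2 - k := by have := pow_pos hy 2; linarith
  have h' : 0 < y' ^ 2 - k := by linarith
  rw [div_le_div_iff₀ (Real.sqrt_pos.2 h) (Real.sqrt_pos.2 h'),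
    ← sq_le_sq₀ (by positivity) (by have := hy.trans hyy; positivity), mul_pow, mul_pow,
    Real.sq_sqrt h.le, Real.sq_sqrt h'.le]
  nlinarith [mul_nonneg (neg_nonneg.2 hk) (sub_pos.2 hsq).le]

namespace RightArc

variable {F f x z x' z' : ℝ → ℝ} {t₀ t₁ r₀ r₁ : ℝ}

/-- Along rising parts of two arcs, the outer arc changes `√(x² + y² - m²)`, `y = z - F x`,
less than the inner one, if `f` changes sign at `m`. -/
theorem sqrt_rise_lt (hf : ∀ u, HasDerivAt F (f u) u) (hF : ContDiff ℝ 1 F)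
    (A : RightArc F x z t₀ t₁) (B : RightArc F x' z' r₀ r₁) (h : z t₀ < z' r₀) {m c : ℝ}
    (hm : 0 < m) (hneg : ∀ u ∈ Ioo 0 m, c * f u < 0) (hpos : ∀ u, m ≤ u → 0 ≤ c * f u)
    {p q : ℝ} (hp : p ∈ Ioo t₀ t₁) (hq : q ∈ Ioo r₀ r₁) (e : x p = x' q)
    (iA : ∀ t ∈ Ico t₀ p, F (x t) < z t) (iB : ∀ t ∈ Ico r₀ q, F (x' t) < z' t)
    (wA : ∀ t ∈ Icc t₀ p, 0 < x t ^ 2 + (z t - F (x t)) ^ 2 - m ^ 2)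
    (wB : ∀ t ∈ Icc r₀ q, 0 < x' t ^ 2 + (z' t - F (x' t)) ^ 2 - m ^ 2) :
    c * (√(x' q ^ 2 + (z' q - F (x' q)) ^ 2 - m ^ 2) -
        √(x' r₀ ^ 2 + (z' r₀ - F (x' r₀)) ^ 2 - m ^ 2)) <
      c * (√(x p ^ 2 + (z p - F (x p)) ^ 2 - m ^ 2) -
        √(x t₀ ^ 2 + (z t₀ - F (x t₀)) ^ 2 - m ^ 2)) := by
  have uA := A.incOn_x hp.1 fun t ht => iA t (Ioo_subset_Ico_self ht)
  have uB := B.incOn_x hq.1 fun t ht => iB t (Ioo_subset_Ico_self ht)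
  have dA : ∀ t ∈ Icc t₀ p, HasDerivAt
      (fun t => c * √(x t ^ 2 + (z t - F (x t)) ^ 2 - m ^ 2)) _ t := fun t ht =>
    (((A.deriv_sq_y hf t).sub_const (m ^ 2)).sqrt (wA t ht).ne').const_mul c
  have dB : ∀ t ∈ Icc r₀ q, HasDerivAt
      (fun t => c * √(x' t ^ 2 + (z' t - F (x' t)) ^ 2 - m ^ 2)) _ t := fun t ht =>
    (((B.deriv_sq_y hf t).sub_const (m ^ 2)).sqrt (wB t ht).ne').const_mul c
  have key : ∀ a ∈ Ioo t₀ p, ∀ b ∈ Ioo r₀ q, x a = x' b →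
      (-(c * f (x' b)) * ((z' b - F (x' b)) / √(x' b ^ 2 + (z' b - F (x' b)) ^ 2 - m ^ 2)) ≤
        -(c * f (x a)) * ((z a - F (x a)) / √(x a ^ 2 + (z a - F (x a)) ^ 2 - m ^ 2))) ∧
      (x a < m →
        -(c * f (x' b)) * ((z' b - F (x' b)) / √(x' b ^ 2 + (z' b - F (x' b)) ^ 2 - m ^ 2)) <
        -(c * f (x a)) * ((z a - F (x a)) / √(x a ^ 2 + (z a - F (x a)) ^ 2 - m ^ 2))) := by
    intro a ha b hb hab
    have hz := A.z_lt_of_x_eq hF B h ⟨ha.1.le, (ha.2.trans hp.2).le⟩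
      ⟨hb.1.le, (hb.2.trans hq.2).le⟩ (fun t ht => iA t ⟨ht.1.le, (ht.2.trans ha.2)⟩)
      (fun t ht => iB t ⟨ht.1.le, (ht.2.trans hb.2)⟩) hab
    have hx := A.pos a ⟨ha.1, ha.2.trans hp.2⟩
    have yA := sub_pos.2 (iA a (Ioo_subset_Ico_self ha))
    have w := wA a (Ioo_subset_Icc_self ha)
    rw [← hab]
    have hy : z a - F (x a) < z' b - F (x a) := by linarith
    generalize z a - F (x a) = y at *
    generalize z' b - F (x a) = y' at *
    have e₁ : x a ^ 2 + y ^ 2 - m ^ 2 = y ^ 2 - (m ^ 2 - x a ^ 2) := by ring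
    have e₂ : x a ^ 2 + y' ^ 2 - m ^ 2 = y' ^ 2 - (m ^ 2 - x a ^ 2) := by ring
    rw [e₁] at w
    rw [e₁, e₂]
    have lt : x a < m → -(c * f (x a)) * (y' / √(y' ^ 2 - (m ^ 2 - x a ^ 2))) <
        -(c * f (x a)) * (y / √(y ^ 2 - (m ^ 2 - x a ^ 2))) := fun hlt =>
      mul_lt_mul_of_pos_left (div_sqrt_lt yA hy (by nlinarith) w)
        (neg_pos.2 (hneg _ ⟨hx, hlt⟩))
    refine ⟨?_, lt⟩
    rcases lt_or_ge (x a) m with hlt | hge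
    · exact (lt hlt).le
    · exact mul_le_mul_of_nonpos_left (div_sqrt_le yA hy (by nlinarith))
        (neg_nonpos.2 (hpos _ hge))
  obtain ⟨a, ha, ham⟩ := A.exists_small hm hp.1
  have := (uA.sub_le_sub_of_rate_le uB (by rw [A.x₀, B.x₀]) e
    (ρ₁ := fun t => -(c * f (x t)) *
      ((z t - F (x t)) / √(x t ^ 2 + (z t - F (x t)) ^ 2 - m ^ 2)))
    (ρ₂ := fun t => -(c * f (x' t)) *
      ((z' t - F (x' t)) / √(x' t ^ 2 + (z' t - F (x' t)) ^ 2 - m ^ 2)))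
    (HasDerivAt.continuousOn dA) (HasDerivAt.continuousOn dB)
    (fun t ht => (dA t (Ioo_subset_Icc_self ht)).congr_deriv (by
      have := (Real.sqrt_pos.2 (wA t (Ioo_subset_Icc_self ht))).ne'
      field_simp))
    (fun t ht => (dB t (Ioo_subset_Icc_self ht)).congr_deriv (by
      have := (Real.sqrt_pos.2 (wB t (Ioo_subset_Icc_self ht))).ne'
      field_simp))
    (fun a ha b hb hab => (key a ha b hb hab).1)).2
    ⟨a, ha, fun b hb hab => (key a ha b hb hab).2 ham⟩
  simp only [← mul_sub] at this
  exact this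

/-- An arc that starts outside of the disc of radius `m` and goes beyond the line `x = m` stays
outside of the disc in the `(x, y)`-plane, if `f < 0` on `(0, m)`. -/
theorem sq_y_gt (hf : ∀ u, HasDerivAt F (f u) u) (A : RightArc F x z t₀ t₁) {m : ℝ}
    (hm : 0 < m) (hF0 : F 0 = 0) (hnp : ∀ u ∈ Icc 0 m, f u ≤ 0) (h₀ : m < z t₀)
    (hA : ∃ t ∈ Icc t₀ t₁, m < x t) :
    ∀ t ∈ Icc t₀ t₁, 0 < x t ^ 2 + (z t - F (x t)) ^ 2 - m ^ 2 := by
  obtain ⟨p, hp, -, up, down⟩ := A.exists_peak hf hF0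
  obtain ⟨s, s', hs, hss, hs', es, es', upA, downA, geA, geA', leA⟩ := A.exists_cross hf hF0 hm hA
  obtain ⟨τ, hτ, hmτ⟩ := hA
  have hmp := hmτ.trans_le (A.le_peak hp up down hτ)
  have mid : ∀ t ∈ Icc s s', 0 < x t ^ 2 + (z t - F (x t)) ^ 2 - m ^ 2 := by
    intro t ht
    have hx := leA t ht
    rcases lt_trichotomy t p with l | rfl | l
    · have := pow_pos (sub_pos.2 (up t ⟨hs.le.trans ht.1, l⟩)) 2
      nlinarith
    · nlinarith [sq_nonneg (z t - F (x t))]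
    · have := sq_pos_of_neg (sub_neg.2 (down t ⟨l, ht.2.trans hs'.le⟩))
      nlinarith
  have gain : ∀ a b, t₀ ≤ a → a ≤ b → b ≤ t₁ → (∀ t ∈ Ioo a b, x t ≤ m) →
      x a ^ 2 + (z a - F (x a)) ^ 2 ≤ x b ^ 2 + (z b - F (x b)) ^ 2 := by
    intro a b ha hab hb hle
    refine le_of_deriv_nonneg (A.deriv_sq_y hf) hab fun t ht => ?_
    have := hnp (x t) ⟨A.nonneg ⟨by linarith [ht.1], by linarith [ht.2]⟩, hle t ht⟩
    have := mul_nonneg (neg_nonneg.2 this) (sq_nonneg (z t - F (x t)))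
    linarith
  intro t ht
  rcases le_total t s with h | h
  · have := gain t₀ t le_rfl ht.1 ht.2 fun τ hτ => geA τ ⟨hτ.1.le, (hτ.2.trans_le h).le⟩
    rw [A.x₀, hF0] at this
    nlinarith
  rcases le_total t s' with h' | h'
  · exact mid t ⟨h, h'⟩
  · have := gain s' t (hs.trans hss).le h' ht.2
      fun τ hτ => geA' τ ⟨hτ.1.le, (hτ.2.trans_le ht.2).le⟩
    linarith [mid s' ⟨hss.le, le_rfl⟩]

/-- If `f` changes sign from negative to positive at `m`, the outer arc gains less of
`√(z² - m²)`. -/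
theorem sqrt_sub_sqrt_lt (hf : ∀ u, HasDerivAt F (f u) u) (hF : ContDiff ℝ 1 F)
    (A : RightArc F x z t₀ t₁) (B : RightArc F x' z' r₀ r₁) (h : z t₀ < z' r₀) {m : ℝ}
    (hm : 0 < m) (hF0 : F 0 = 0) (hneg : ∀ u ∈ Ioo 0 m, f u < 0) (hnp : ∀ u ∈ Icc 0 m, f u ≤ 0)
    (hpos : ∀ u, m ≤ u → 0 ≤ f u) (h₀ : m < z t₀) (hA : ∃ t ∈ Icc t₀ t₁, m < x t)
    (hB : ∃ t ∈ Icc r₀ r₁, m < x' t) :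
    √(z' r₁ ^ 2 - m ^ 2) - √(z' r₀ ^ 2 - m ^ 2) <
      √(z t₁ ^ 2 - m ^ 2) - √(z t₀ ^ 2 - m ^ 2) := by
  have wA := A.sq_y_gt hf hm hF0 hnp h₀ hA
  have wB := B.sq_y_gt hf hm hF0 hnp (h₀.trans h) hB
  obtain ⟨p, hp, ep, up, down⟩ := A.exists_peak hf hF0
  obtain ⟨p', hp', ep', up', down'⟩ := B.exists_peak hf hF0
  obtain ⟨τ, hτ, hmτ⟩ := hA
  have hmp := hmτ.trans_le (A.le_peak hp up down hτ)
  have hpp : x p < x' p' := by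
    by_contra hcon
    obtain ⟨a, ha, ea⟩ := intermediate_value_Icc hp.1.le A.contX.continuousOn
      (show x' p' ∈ Icc _ _ from ⟨by rw [A.x₀]; exact (B.pos p' hp').le, not_lt.1 hcon⟩)
    have := A.z_lt_of_x_eq hF B h ⟨ha.1, ha.2.trans hp.2.le⟩ (Ioo_subset_Icc_self hp')
      (fun t ht => up t ⟨ht.1.le, ht.2.trans_le ha.2⟩) (fun t ht => up' t ⟨ht.1.le, ht.2⟩) ea
    rw [ep', ← ea] at this
    rcases ha.2.eq_or_lt with e | l
    · rw [e, ep] at this; exact lt_irrefl _ this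
    · exact (up a ⟨ha.1, l⟩).asymm this
  obtain ⟨q, q', hq, hqq, hq', eq, eq', upB, downB, -, -, leB⟩ :=
    B.exists_cross hf hF0 (hm.trans hmp) ⟨p', Ioo_subset_Icc_self hp', hpp⟩
  have top := A.sqrt_rise_lt hf hF B h (c := 1) hm (by simpa using hneg) (by simpa using hpos)
    hp ⟨hq, hqq.trans hq'⟩ eq.symm up (fun t ht => upB t (Ico_subset_Icc_self ht))
    (fun t ht => wA t ⟨ht.1, ht.2.trans hp.2.le⟩)
    (fun t ht => wB t ⟨ht.1, ht.2.trans (hqq.trans hq').le⟩)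
  have hf' : ∀ u, HasDerivAt (fun u => -F u) (-f u) u := fun u => (hf u).neg
  have bot := A.rev.sqrt_rise_lt hf' (by fun_prop) B.rev
    (by simpa using A.end_lt hF B h) (c := -1) (m := m) hm (by simpa using hneg)
    (by simpa using hpos) (p := -p) (q := -q') ⟨neg_lt_neg hp.2, neg_lt_neg hp.1⟩
    ⟨neg_lt_neg hq', neg_lt_neg (hq.trans hqq)⟩ (by simpa using eq'.symm)
    (fun t ht => neg_lt_neg (down (-t) ⟨by linarith [ht.2], by linarith [ht.1]⟩))
    (fun t ht => neg_lt_neg (downB (-t) ⟨by linarith [ht.2], by linarith [ht.1]⟩))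
    (fun t ht => by
      have := wA (-t) ⟨by linarith [ht.2, hp.1], by linarith [ht.1]⟩
      have e : (-z (-t) - -F (x (-t))) ^ 2 = (z (-t) - F (x (-t))) ^ 2 := by ring
      rwa [e])
    (fun t ht => by
      have := wB (-t) ⟨by linarith [ht.2], by linarith [ht.1]⟩
      have e : (-z' (-t) - -F (x' (-t))) ^ 2 = (z' (-t) - F (x' (-t))) ^ 2 := by ring
      rwa [e])
  have mid : √(x' q' ^ 2 + (z' q' - F (x' q')) ^ 2 - m ^ 2) ≤
      √(x' q ^ 2 + (z' q - F (x' q)) ^ 2 - m ^ 2) := by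
    apply Real.sqrt_le_sqrt
    have := le_of_deriv_nonneg (fun t => (B.deriv_sq_y hf t).neg) hqq.le fun t ht => by
      have := hpos (x' t) (hmp.le.trans (leB t (Ioo_subset_Icc_self ht)))
      have := mul_nonneg this (sq_nonneg (z' t - F (x' t)))
      linarith
    simp only [Pi.neg_apply] at this
    linarith
  have e : ∀ t, (-z t - -F (x t)) ^ 2 = (z t - F (x t)) ^ 2 := fun t => by ring
  have e' : ∀ t, (-z' t - -F (x' t)) ^ 2 = (z' t - F (x' t)) ^ 2 := fun t => by ring
  simp only [neg_neg, e, e'] at bot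
  simp only [A.x₀, A.x₁, B.x₀, B.x₁, hF0, sub_zero, zero_pow two_ne_zero, zero_add] at top bot
  linarith

end RightArc

/-- `f` is negative on `[0, m)` and positive on `(m, ∞)`. -/
structure IsDip (f : ℝ → ℝ) (m : ℝ) : Prop where
  pos : 0 < m
  root : f m = 0
  neg : ∀ u ∈ Ico 0 m, f u < 0
  gt : ∀ u, m < u → 0 < f u

/-- `F` vanishes at `0` and `α`, is negative in between, and increases beyond `α`. -/
structure IsHump (F : ℝ → ℝ) (α : ℝ) : Prop where
  pos : 0 < α
  zero : F 0 = 0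
  root : F α = 0
  neg : ∀ u ∈ Ioo 0 α, F u < 0
  mono : MonotoneOn F (Ici α)

theorem isDip_of_deriv_pos {f : ℝ → ℝ} {m d : ℝ} (cf : Continuous f) (hm : 0 < m) (h0 : f m = 0)
    (hz : ∀ u, 0 ≤ u → f u = 0 → u = m) (hd : HasDerivAt f d m) (hpos : 0 < d) : IsDip f m where
  pos := hm
  root := h0
  neg u hu := by
    by_contra hcon
    obtain ⟨c, hc, hc'⟩ := ((eventually_pos_of_deriv_neg hd.neg (by simp [h0])
      (neg_lt_zero.2 hpos)).and (Ioo_mem_nhdsLT hu.2)).exists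
    simp only [Pi.neg_apply] at hc
    obtain ⟨v, hv, hv'⟩ := intermediate_value_Icc' hc'.1.le cf.continuousOn
      (show (0 : ℝ) ∈ Icc _ _ from ⟨by linarith, not_lt.1 hcon⟩)
    exact (hv.2.trans_lt hc'.2).ne (hz v (hu.1.trans hv.1) hv')
  gt u hu := by
    by_contra hcon
    obtain ⟨c, hc, hc'⟩ := ((eventually_neg_of_deriv_neg hd.neg (by simp [h0])
      (neg_lt_zero.2 hpos)).and (Ioo_mem_nhdsGT hu)).exists
    simp only [Pi.neg_apply] at hc
    obtain ⟨v, hv, hv'⟩ := intermediate_value_Icc' hc'.2.le cf.continuousOn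
      (show (0 : ℝ) ∈ Icc _ _ from ⟨not_lt.1 hcon, by linarith⟩)
    have := hc'.1.trans_le hv.1
    exact this.ne' (hz v (hm.trans this).le hv')

namespace IsDip

variable {F f : ℝ → ℝ} {m : ℝ}

theorem nonpos (h : IsDip f m) : ∀ u ∈ Icc 0 m, f u ≤ 0 := by
  intro u hu
  rcases hu.2.eq_or_lt with rfl | h'
  · exact h.root.le
  · exact (h.neg u ⟨hu.1, h'⟩).le

theorem nonneg (h : IsDip f m) : ∀ u, m ≤ u → 0 ≤ f u := by
  intro u hu
  rcases hu.eq_or_lt with rfl | h'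
  · exact h.root.ge
  · exact (h.gt u h').le

theorem const_mul (h : IsDip f m) {c : ℝ} (hc : 0 < c) : IsDip (fun u => c * f u) m where
  pos := h.pos
  root := by simp [h.root]
  neg u hu := mul_neg_of_pos_of_neg hc (h.neg u hu)
  gt u hu := mul_pos hc (h.gt u hu)

theorem isHump (h : IsDip f m) (hf : ∀ u, HasDerivAt F (f u) u) (hF0 : F 0 = 0) {α : ℝ}
    (hα : m < α) (hFα : F α = 0) : IsHump F α := by
  have cF : Continuous F := continuous_iff_continuousAt.2 fun u => (hf u).continuousAt
  have anti : StrictAntiOn F (Icc 0 m) := by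
    refine strictAntiOn_of_deriv_neg (convex_Icc _ _) cF.continuousOn fun u hu => ?_
    rw [interior_Icc] at hu
    rw [(hf u).deriv]
    exact h.neg u (Ioo_subset_Ico_self hu)
  have mono : StrictMonoOn F (Ici m) := by
    refine strictMonoOn_of_deriv_pos (convex_Ici _) cF.continuousOn fun u hu => ?_
    rw [interior_Ici] at hu
    rw [(hf u).deriv]
    exact h.gt u hu
  refine ⟨h.pos.trans hα, hF0, hFα, fun u hu => ?_, mono.monotoneOn.mono (Ici_subset_Ici.2 hα.le)⟩
  rcases le_total u m with hum | hum
  · exact hF0 ▸ anti ⟨le_rfl, h.pos.le⟩ ⟨hu.1.le, hum⟩ hu.1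
  · exact hFα ▸ mono hum hα.le hu.2

/-- If `f` increases for `u > 0`, then so does `F(u) / u`, strictly beyond the root of `f`. -/
theorem ratio_mono (h : IsDip f m) (hf : ∀ u, HasDerivAt F (f u) u) (hF0 : F 0 = 0)
    (hmono : MonotoneOn f (Ioi 0)) {u v : ℝ} (hu : 0 < u) (huv : u < v) :
    F u * v ≤ F v * u ∧ (m < v → F u * v < F v * u) := by
  have mvt : ∀ a b, a < b → ∃ c ∈ Ioo a b, F b - F a = f c * (b - a) := by
    intro a b hab
    obtain ⟨c, hc, e⟩ := exists_hasDerivAt_eq_slope F f hab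
      (HasDerivAt.continuousOn fun t _ => hf t) fun t _ => hf t
    exact ⟨c, hc, by rw [e]; field_simp [(sub_pos.2 hab).ne']⟩
  have weak : ∀ {a b}, 0 < a → a < b → F a * b ≤ F b * a := by
    intro a b ha hab
    obtain ⟨c, hc, e⟩ := mvt 0 a ha
    obtain ⟨d, hd, e'⟩ := mvt a b hab
    have := hmono hc.1 (ha.trans hd.1) (hc.2.trans hd.1).le
    rw [hF0, sub_zero, sub_zero] at e
    have := mul_nonneg (mul_pos ha (sub_pos.2 hab)).le (sub_nonneg.2 this)
    linear_combination this - a * e' + (b - a) * e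
  have strict : ∀ {b}, m < b → F m * b < F b * m := by
    intro b hb
    obtain ⟨c, hc, e⟩ := mvt 0 m h.pos
    obtain ⟨d, hd, e'⟩ := mvt m b hb
    have := (h.neg c (Ioo_subset_Ico_self hc)).trans (h.gt d hd.1)
    rw [hF0, sub_zero, sub_zero] at e
    have := mul_pos (mul_pos h.pos (sub_pos.2 hb)) (sub_pos.2 this)
    linear_combination this - m * e' + (b - m) * e
  refine ⟨weak hu huv, fun hmv => ?_⟩
  rcases lt_trichotomy u m with l | rfl | l
  · have h₁ := mul_le_mul_of_nonneg_right (weak hu l) (hu.trans huv).le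
    have h₂ := mul_lt_mul_of_pos_right (strict hmv) hu
    refine lt_of_mul_lt_mul_right ?_ h.pos.le
    linarith
  · exact strict hmv
  · obtain ⟨c, hc, e⟩ := mvt m u l
    obtain ⟨d, hd, e'⟩ := mvt u v huv
    obtain ⟨b, hb, e''⟩ := mvt 0 m h.pos
    have h₁ := hmono (h.pos.trans hc.1) (hu.trans hd.1) (hc.2.trans hd.1).le
    have h₂ := h.neg b (Ioo_subset_Ico_self hb)
    have h₃ := h.gt d (l.trans hd.1)
    rw [hF0, sub_zero, sub_zero] at e''
    have h₄ : F u < u * f d := by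
      nlinarith [mul_pos h.pos (neg_pos.2 h₂), mul_pos h.pos h₃,
        mul_nonneg (sub_nonneg.2 l.le) (sub_nonneg.2 h₁)]
    have := mul_pos (sub_pos.2 huv) (sub_pos.2 h₄)
    linear_combination this - u * e'

end IsDip

/-- A right arc followed by a left arc, which is written as a right arc of the reflected system,
leading back to the starting point. -/
structure LienardCycle (F G x z : ℝ → ℝ) (t₀ t₁ t₂ : ℝ) : Prop where
  right : RightArc F x z t₀ t₁
  left : RightArc G (fun t => -x t) (fun t => -z t) t₁ t₂
  closed : z t₂ = z t₀

namespace RightArc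

variable {F G f g x z x' z' : ℝ → ℝ} {t₀ t₁ r₀ r₁ α β : ℝ}

/-- Of two half-arcs forming a cycle, the one on the side of the narrower hump leaves its strip. -/
theorem exists_lt_of_isHump (hg : ∀ u, HasDerivAt G (g u) u) (A : RightArc F x z t₀ t₁)
    (A' : RightArc G x' z' r₀ r₁) (e : z' r₀ = -z t₁) (e' : z t₀ = -z' r₁) (hF : IsHump F α)
    (hG : IsHump G β) (hαβ : α ≤ β) : ∃ t ∈ Icc t₀ t₁, α < x t := by
  by_contra! hcon
  obtain ⟨h₁, h₂⟩ := A.gain_of_le hF.pos hF.zero hF.root hF.neg hcon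
  by_cases hr : ∃ t ∈ Icc r₀ r₁, β < x' t
  · have := A'.le_end_of_reach hg hG.pos hG.zero hG.neg hG.root hr
    linarith
  · push Not at hr
    have := (A'.gain_of_le hG.pos hG.zero hG.root hG.neg hr).1
    linarith

/-- Of two half-arcs forming a cycle, the one on the side of the narrower dip leaves its strip. -/
theorem exists_lt_of_isDip (hf : ∀ u, HasDerivAt F (f u) u) (hg : ∀ u, HasDerivAt G (g u) u)
    (A : RightArc F x z t₀ t₁) (A' : RightArc G x' z' r₀ r₁) (e : z' r₀ = -z t₁)
    (e' : z t₀ = -z' r₁) (hF0 : F 0 = 0) (hG0 : G 0 = 0) (h : IsDip f α) (h' : IsDip g β)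
    (hαβ : α ≤ β) : ∃ t ∈ Icc t₀ t₁, α < x t := by
  by_contra! hcon
  obtain ⟨h₁, h₂⟩ := A.gain_of_le' hf h.pos hF0 (fun u hu => h.neg u (Ioo_subset_Ico_self hu))
    h.root hcon
  by_cases hr : ∃ t ∈ Icc r₀ r₁, β < x' t
  · have := A'.lt_end_of_reach hg h'.pos hG0 (fun u hu => h'.neg u (Ioo_subset_Ico_self hu))
      h'.root hr
    linarith
  · push Not at hr
    have := (A'.gain_of_le' hg h'.pos hG0 (fun u hu => h'.neg u (Ioo_subset_Ico_self hu))
      h'.root hr).1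
    linarith

end RightArc

namespace LienardCycle

variable {F G f g x z x' z' : ℝ → ℝ} {t₀ t₁ t₂ r₀ r₁ r₂ α β m M : ℝ}

theorem left_lt (hF : ContDiff ℝ 1 F) (C : LienardCycle F G x z t₀ t₁ t₂)
    (D : LienardCycle F G x' z' r₀ r₁ r₂)
    (h : z t₀ < z' r₀) : -z t₁ < -z' r₁ :=
  neg_lt_neg (C.right.end_lt hF D.right h)

theorem eq_neg_neg (C : LienardCycle F G x z t₀ t₁ t₂) : z t₀ = -(fun t => -z t) t₂ := by
  simp [C.closed]

theorem not_lt_of_isHump (hf : ∀ u, HasDerivAt F (f u) u) (hg : ∀ u, HasDerivAt G (g u) u)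
    (hF : ContDiff ℝ 1 F) (hG : ContDiff ℝ 1 G) (C : LienardCycle F G x z t₀ t₁ t₂)
    (D : LienardCycle F G x' z' r₀ r₁ r₂) (h₁ : IsHump F α) (h₂ : IsHump G α) : ¬ z t₀ < z' r₀ := by
  intro h
  have k₁ := C.right.sq_sub_sq_lt hf hF D.right h h₁.pos h₁.zero h₁.root h₁.neg h₁.mono
    (C.right.exists_lt_of_isHump hg C.left rfl C.eq_neg_neg h₁ h₂ le_rfl)
    (D.right.exists_lt_of_isHump hg D.left rfl D.eq_neg_neg h₁ h₂ le_rfl)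
  have k₂ := C.left.sq_sub_sq_lt hg hG D.left (C.left_lt hF D h) h₂.pos h₂.zero h₂.root h₂.neg
    h₂.mono (C.left.exists_lt_of_isHump hf C.right C.eq_neg_neg rfl h₂ h₁ le_rfl)
    (D.left.exists_lt_of_isHump hf D.right D.eq_neg_neg rfl h₂ h₁ le_rfl)
  simp only [neg_sq, C.closed, D.closed] at k₂
  linarith

theorem not_lt_of_isDip (hf : ∀ u, HasDerivAt F (f u) u) (hg : ∀ u, HasDerivAt G (g u) u)
    (hF : ContDiff ℝ 1 F) (hG : ContDiff ℝ 1 G) (C : LienardCycle F G x z t₀ t₁ t₂)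
    (D : LienardCycle F G x' z' r₀ r₁ r₂) (hF0 : F 0 = 0) (hG0 : G 0 = 0) (h₁ : IsDip f m)
    (h₂ : IsDip g m) : ¬ z t₀ < z' r₀ := by
  intro h
  have n₁ : ∀ u ∈ Ioo 0 m, f u < 0 := fun u hu => h₁.neg u (Ioo_subset_Ico_self hu)
  have n₂ : ∀ u ∈ Ioo 0 m, g u < 0 := fun u hu => h₂.neg u (Ioo_subset_Ico_self hu)
  have cR := C.right.exists_lt_of_isDip hf hg C.left rfl C.eq_neg_neg hF0 hG0 h₁ h₂ le_rfl
  have dR := D.right.exists_lt_of_isDip hf hg D.left rfl D.eq_neg_neg hF0 hG0 h₁ h₂ le_rfl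
  have cL := C.left.exists_lt_of_isDip hg hf C.right C.eq_neg_neg rfl hG0 hF0 h₂ h₁ le_rfl
  have dL := D.left.exists_lt_of_isDip hg hf D.right D.eq_neg_neg rfl hG0 hF0 h₂ h₁ le_rfl
  have k₁ := C.right.sqrt_sub_sqrt_lt hf hF D.right h h₁.pos hF0 n₁ h₁.nonpos h₁.nonneg
    (by simpa [C.closed] using C.left.lt_end_of_reach hg h₂.pos hG0 n₂ h₂.root cL) cR dR
  have k₂ := C.left.sqrt_sub_sqrt_lt hg hG D.left (C.left_lt hF D h) h₂.pos hG0 n₂ h₂.nonpos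
    h₂.nonneg (C.right.lt_end_of_reach hf h₁.pos hF0 n₁ h₁.root cR) cL dL
  simp only [neg_sq, C.closed, D.closed] at k₂
  linarith

theorem not_lt_of_mono (hf : ∀ u, HasDerivAt F (f u) u) (hg : ∀ u, HasDerivAt G (g u) u)
    (cf : Continuous f) (cg : Continuous g)
    (hF : ContDiff ℝ 1 F) (hG : ContDiff ℝ 1 G) (C : LienardCycle F G x z t₀ t₁ t₂)
    (D : LienardCycle F G x' z' r₀ r₁ r₂) (hF0 : F 0 = 0) (hG0 : G 0 = 0) (h₁ : IsDip f m)
    (h₂ : IsDip g M) (m₁ : MonotoneOn f (Ioi 0)) (m₂ : MonotoneOn g (Ioi 0)) :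
    ¬ z t₀ < z' r₀ := by
  intro h
  have k₁ := C.right.log_sub_log_of_ratio_mono hf cf hF D.right h hF0
    fun u v hu huv => (h₁.ratio_mono hf hF0 m₁ hu huv).1
  have k₂ := C.left.log_sub_log_of_ratio_mono hg cg hG D.left (C.left_lt hF D h) hG0
    fun u v hu huv => (h₂.ratio_mono hg hG0 m₂ hu huv).1
  simp only [neg_sq, C.closed, D.closed] at k₂
  rcases le_total m M with hm | hm
  · have := k₁.2 m h₁.pos (fun u v hu huv => (h₁.ratio_mono hf hF0 m₁ hu huv).2)
      (D.right.exists_lt_of_isDip hf hg D.left rfl D.eq_neg_neg hF0 hG0 h₁ h₂ hm)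
    linarith [k₂.1]
  · have := k₂.2 M h₂.pos (fun u v hu huv => (h₂.ratio_mono hg hG0 m₂ hu huv).2)
      (D.left.exists_lt_of_isDip hg hf D.right D.eq_neg_neg rfl hG0 hF0 h₂ h₁ hm)
    linarith [k₁.1]

theorem not_lt_of_ratio_mono (hf : ∀ u, HasDerivAt F (f u) u) (hg : ∀ u, HasDerivAt G (g u) u)
    (cf : Continuous f) (cg : Continuous g)
    (hF : ContDiff ℝ 1 F) (hG : ContDiff ℝ 1 G) (C : LienardCycle F G x z t₀ t₁ t₂)
    (D : LienardCycle F G x' z' r₀ r₁ r₂) (h₁ : IsHump F α) (h₂ : IsHump G β) (hαβ : α ≤ β)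
    (m₁ : ∀ u v, α ≤ u → u < v → F u * v ≤ F v * u)
    (m₂ : ∀ u v, 0 < u → u < v → G u * v ≤ G v * u) : ¬ z t₀ < z' r₀ := by
  intro h
  have k₁ := C.right.log_sub_log_lt_of_strip hf cf hF D.right h h₁.pos h₁.zero h₁.root h₁.neg m₁
    (C.right.exists_lt_of_isHump hg C.left rfl C.eq_neg_neg h₁ h₂ hαβ)
    (D.right.exists_lt_of_isHump hg D.left rfl D.eq_neg_neg h₁ h₂ hαβ)
  have k₂ := (C.left.log_sub_log_of_ratio_mono hg cg hG D.left (C.left_lt hF D h) h₂.zero m₂).1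
  simp only [neg_sq, C.closed, D.closed] at k₂
  linarith

end LienardCycle

namespace IsSol

variable {F x z : ℝ → ℝ} {T t₀ t₁ : ℝ}

theorem eq_zero (hF : ContDiff ℝ 1 F) (hF0 : F 0 = 0) (h : IsSol F x z) (hx : x t₀ = 0)
    (hz : z t₀ = 0) (t : ℝ) : x t = 0 ∧ z t = 0 := by
  have h0 : IsSol F (fun _ => 0) (fun _ => 0) :=
    ⟨fun t => by simpa [hF0] using hasDerivAt_const t (0 : ℝ),
      fun t => by simpa using hasDerivAt_const t (0 : ℝ)⟩
  simpa using h.eq_shift hF h0 (s := t₀) (r := 0) hx hz (t - t₀)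

/-- A periodic solution starting on the positive `z`-axis returns to the `z`-axis. -/
theorem exists_rightArc (hF : ContDiff ℝ 1 F) (hF0 : F 0 = 0) (h : IsSol F x z) (hT : 0 < T)
    (hp : ∀ t, x (t + T) = x t) (hx : x t₀ = 0) (hz : 0 < z t₀) :
    ∃ t₁, RightArc F x z t₀ t₁ := by
  obtain ⟨u, hu, hu'⟩ := (mem_nhdsGT_iff_exists_Ioo_subset.1 (eventually_neg_of_deriv_neg
    (h.hx t₀).neg (by simp [hx]) (by rw [hx, hF0]; linarith)))
  simp only [Pi.neg_apply, subset_def, mem_ofPred_eq, neg_lt_zero] at hu'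
  set c := (t₀ + u) / 2 with hc
  have hu : t₀ < u := hu
  have hc₀ : t₀ < c := by linarith
  have hcu : c < u := by linarith
  have xT : x (t₀ + T) = 0 := by rw [hp, hx]
  have hpos : ∀ t ∈ Ioc t₀ c, 0 < x t := fun t ht => hu' t ⟨ht.1, ht.2.trans_lt hcu⟩
  have hcT : c < t₀ + T := by
    by_contra hcon
    exact (hpos _ ⟨by linarith, not_lt.1 hcon⟩).ne' xT
  obtain ⟨t₁, ⟨ht₁, hx₁⟩, hmin⟩ := (isCompact_Icc.inter_right
    (isClosed_singleton.preimage h.contX) : IsCompact (Icc c (t₀ + T) ∩ x ⁻¹' {0})).exists_isLeast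
    ⟨t₀ + T, ⟨hcT.le, le_rfl⟩, xT⟩
  have hx₁ : x t₁ = 0 := hx₁
  have lt : t₀ < t₁ := hc₀.trans_le ht₁.1
  have pos : ∀ t ∈ Ioo t₀ t₁, 0 < x t := by
    intro t ht
    rcases le_total t c with htc | htc
    · exact hpos t ⟨ht.1, htc⟩
    by_contra hcon
    obtain ⟨v, hv, hv'⟩ := intermediate_value_Icc' htc h.contX.continuousOn
      (show (0 : ℝ) ∈ Icc _ _ from ⟨not_lt.1 hcon, (hpos c ⟨hc₀, le_rfl⟩).le⟩)
    exact absurd (hmin ⟨⟨hv.1, (hv.2.trans ht.2.le).trans ht₁.2⟩, hv'⟩)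
      (not_le.2 (hv.2.trans_lt ht.2))
  refine ⟨t₁, h, lt, hx, hx₁, pos, hz, lt_of_not_ge fun hz₁ => ?_⟩
  rcases hz₁.eq_or_lt with h0 | h0
  · exact hz.ne' (h.eq_zero hF hF0 hx₁ h0.symm t₀).2
  · obtain ⟨s, hs, hs'⟩ := ((eventually_pos_of_deriv_neg (h.hx t₁).neg (by simp [hx₁])
      (by rw [hx₁, hF0]; linarith)).and (Ioo_mem_nhdsLT lt)).exists
    simp only [Pi.neg_apply] at hs
    linarith [pos s hs']

/-- A periodic solution on the negative `z`-axis comes from the positive `z`-axis. -/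
theorem exists_rightArc_before (hF : ContDiff ℝ 1 F) (hF0 : F 0 = 0) (h : IsSol F x z)
    (hT : 0 < T) (hp : ∀ t, x (t + T) = x t) (hx : x t₁ = 0) (hz : z t₁ < 0) :
    ∃ t₀, RightArc F x z t₀ t₁ := by
  obtain ⟨s, A⟩ := h.rev.exists_rightArc hF.neg (by simp [hF0]) hT (t₀ := -t₁)
    (fun t => by rw [← hp]; congr 1; ring) (by simpa) (by simpa)
  exact ⟨-s, by simpa using A.rev⟩

/-- A nontrivial periodic solution starts a cycle at the point where `z` is largest. -/
theorem exists_cycle {G : ℝ → ℝ} (hG : G = fun u => -F (-u)) (hF : ContDiff ℝ 1 F)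
    (hF0 : F 0 = 0) (h : IsSol F x z) (hT : 0 < T) (hp : ∀ t, x (t + T) = x t)
    (hpz : ∀ t, z (t + T) = z t) (hne : ∃ t, ¬(x t = 0 ∧ z t = 0)) :
    ∃ t₀ t₁ t₂, LienardCycle F G x z t₀ t₁ t₂ := by
  have hG' : ContDiff ℝ 1 G := hG ▸ (hF.comp contDiff_neg).neg
  have hG0 : G 0 = 0 := by simp [hG, hF0]
  have hn : IsSol G (fun t => -x t) (fun t => -z t) := hG ▸ h.neg
  have hpn : ∀ t, -x (t + T) = -x t := fun t => by rw [hp]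
  have nz : ∀ t, x t = 0 → z t ≠ 0 := fun t hx hz =>
    hne.elim fun s hs => hs (h.eq_zero hF hF0 hx hz s)
  have hper : Function.Periodic z T := hpz
  have hcomp : IsCompact (range z) := by
    rw [← hper.image_Icc hT 0]
    exact isCompact_Icc.image h.contZ
  obtain ⟨_, ⟨a, rfl⟩, ha⟩ := hcomp.exists_isGreatest (range_nonempty z)
  obtain ⟨_, ⟨b, rfl⟩, hb⟩ := hcomp.exists_isLeast (range_nonempty z)
  have ha : ∀ t, z t ≤ z a := fun t => ha (mem_range_self t)
  have hb : ∀ t, z b ≤ z t := fun t => hb (mem_range_self t)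
  have xa : x a = 0 := neg_eq_zero.1
    ((isMaxOn_univ_iff.2 ha).isLocalMax univ_mem |>.hasDerivAt_eq_zero (h.hz a))
  have xb : x b = 0 := neg_eq_zero.1
    ((isMinOn_univ_iff.2 hb).isLocalMin univ_mem |>.hasDerivAt_eq_zero (h.hz b))
  have za : 0 < z a := by
    by_contra hcon
    have zb : z b < 0 := lt_of_le_of_ne ((hb a).trans (not_lt.1 hcon)) (nz b xb)
    obtain ⟨s, A⟩ := hn.exists_rightArc hG' hG0 hT hpn (t₀ := b) (by simp [xb]) (by linarith)
    have := A.z₁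
    linarith [ha s]
  obtain ⟨r₁, L₀⟩ := hn.exists_rightArc_before hG' hG0 hT hpn (t₁ := a) (by simp [xa]) (by linarith)
  obtain ⟨r₀, R₀⟩ := h.exists_rightArc_before hF hF0 hT hp (t₁ := r₁)
    (neg_eq_zero.1 L₀.x₀) (by linarith [L₀.z₀])
  refine ⟨r₀, r₁, a, R₀, L₀, ?_⟩
  by_contra hcon
  have lt : z r₀ < z a := lt_of_le_of_ne (ha r₀) (Ne.symm hcon)
  obtain ⟨s₁, R₁⟩ := h.exists_rightArc hF hF0 hT hp xa za
  obtain ⟨s₂, L₁⟩ := hn.exists_rightArc hG' hG0 hT hpn (t₀ := s₁) (by simp [R₁.x₁])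
    (by linarith [R₁.z₁])
  have := L₀.end_lt hG' L₁ (neg_lt_neg (R₀.end_lt hF R₁ lt))
  linarith [ha s₂]

end IsSol

/-- The Liénard transformation `z = y + λ F(x)`. -/
theorem IsPeriodicSol.isSol {f F x y : ℝ → ℝ} {lam : ℝ} (hf : ∀ u, HasDerivAt F (f u) u)
    (h : IsPeriodicSol f lam x y) :
    IsSol (fun u => lam * F u) x (fun t => y t + lam * F (x t)) where
  hx t := (h.2.1 t).congr_deriv (by ring)
  hz t := ((h.2.2.1 t).add (((hf (x t)).comp t (h.2.1 t)).const_mul lam)).congr_deriv (by ring)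

theorem IsPeriodicSol.exists_cycle {f F x y : ℝ → ℝ} {lam : ℝ} (hf : ∀ u, HasDerivAt F (f u) u)
    (hF : ContDiff ℝ 1 F) (hF0 : F 0 = 0) (h : IsPeriodicSol f lam x y) :
    ∃ t₀ t₁ t₂, LienardCycle (fun u => lam * F u) (fun u => -(lam * F (-u))) x
      (fun t => y t + lam * F (x t)) t₀ t₁ t₂ := by
  obtain ⟨T, hT, hp⟩ := h.1
  refine (h.isSol hf).exists_cycle rfl (contDiff_const.mul hF) (by simp [hF0]) hT
    (fun t => (hp t).1) (fun t => by simp only [(hp t).1, (hp t).2]) ?_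
  by_contra! hcon
  obtain ⟨t₁, t₂, hne⟩ := h.2.2.2
  have : ∀ t, x t = 0 ∧ y t = 0 := fun t => by
    have := hcon t
    exact ⟨this.1, by simpa [this.1, hF0] using this.2⟩
  exact hne (by simp [this])

end

theorem uniqueness_of_limit_cycle (f : ℝ → ℝ) (xM xm : ℝ)
    (hf : ContDiff ℝ 2 f)
    (hxM : xM < 0) (hxm : 0 < xm)
    (hfxM : f xM = 0) (hfxm : f xm = 0)
    (hzeros : ∀ x, f x = 0 → x = xM ∨ x = xm)
    (hdM : deriv f xM < 0) (hdm : 0 < deriv f xm)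
    (F : ℝ → ℝ) (hF : ∀ x, F x = ∫ s in (0:ℝ)..x, f s)
    (x₁ x₂ : ℝ) (hx₁ : x₁ < xM) (hx₂ : xm < x₂)
    (hFx₁ : F x₁ = F xm) (hFx₂ : F x₂ = F xM)
    (x₁s x₂s : ℝ) (hFx₁s : F x₁s = 0) (hFx₂s : F x₂s = 0)
    (h₁ : x₁ < x₁s) (h₁' : x₁s < xM) (h₂ : xm < x₂s) (h₂' : x₂s < x₂)
    (hFzeros : ∀ x, F x = 0 → x = 0 ∨ x = x₁s ∨ x = x₂s)
    (hD : (Tendsto F atTop atTop ∧ Tendsto F atBot atBot ∧ x₁s = -x₂s) ∨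
          (Tendsto F atTop atTop ∧ Tendsto F atBot atBot ∧ xM = -xm) ∨
          (AntitoneOn f (Set.Iio 0) ∧ MonotoneOn f (Set.Ioi 0)) ∨
          (AntitoneOn (fun x => F x / x) (Set.Iio 0) ∧
            MonotoneOn (fun x => F x / x) (Set.Ici x₂s) ∧ x₂s ≤ -x₁s)) :
    ∀ lam : ℝ, 0 < lam → ∀ x y x' y' : ℝ → ℝ,
      IsPeriodicSol f lam x y → IsPeriodicSol f lam x' y' →
      Set.range (fun t => (x t, y t)) = Set.range (fun t => (x' t, y' t)) := by
  intro lam hlam x y x' y' hS hS'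
  have cf : Continuous f := hf.continuous
  have df : ∀ u, HasDerivAt f (deriv f u) u := fun u =>
    (hf.differentiable (by norm_num) u).hasDerivAt
  have dF : ∀ u, HasDerivAt F (f u) u := fun u => by
    rw [funext hF]
    exact intervalIntegral.integral_hasDerivAt_right (cf.intervalIntegrable _ _)
      cf.aestronglyMeasurable.stronglyMeasurableAtFilter cf.continuousAt
  have hF0 : F 0 = 0 := by simp [hF]
  have cdF : ContDiff ℝ 1 F := contDiff_one_iff_deriv.2
    ⟨fun u => (dF u).differentiableAt, by rwa [funext fun u => (dF u).deriv]⟩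
  obtain ⟨t₀, t₁, t₂, C⟩ := hS.exists_cycle dF cdF hF0
  obtain ⟨r₀, r₁, r₂, D⟩ := hS'.exists_cycle dF cdF hF0
  set F' : ℝ → ℝ := fun u => lam * F u with hF'
  set G' : ℝ → ℝ := fun u => -(lam * F (-u)) with hG'
  set f' : ℝ → ℝ := fun u => lam * f u with hf'
  set g' : ℝ → ℝ := fun u => lam * f (-u) with hg'
  have dF' : ∀ u, HasDerivAt F' (f' u) u := fun u => (dF u).const_mul lam
  have dG' : ∀ u, HasDerivAt G' (g' u) u := fun u =>
    ((((dF (-u)).comp u (hasDerivAt_neg u)).const_mul lam).neg).congr_deriv (by simp [hg'])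
  have cf' : Continuous f' := continuous_const.mul cf
  have cg' : Continuous g' := continuous_const.mul (cf.comp continuous_neg)
  have cdF' : ContDiff ℝ 1 F' := contDiff_const.mul cdF
  have cdG' : ContDiff ℝ 1 G' := (cdF'.comp contDiff_neg).neg
  have hF'0 : F' 0 = 0 := by simp [hF', hF0]
  have hG'0 : G' 0 = 0 := by simp [hG', hF0]
  have dip₁ : IsDip f' xm := (isDip_of_deriv_pos cf hxm hfxm
    (fun u hu h0 => (hzeros u h0).resolve_left (hxM.trans_le hu).ne') (df xm) hdm).const_mul hlam
  have dip₂ : IsDip g' (-xM) := (isDip_of_deriv_pos (f := fun u => f (-u))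
    (cf.comp continuous_neg) (neg_pos.2 hxM) (by simpa)
    (fun u hu h0 => by
      rcases hzeros _ h0 with h | h
      · exact neg_eq_iff_eq_neg.1 h
      · linarith)
    ((df (- -xM)).comp (-xM) (hasDerivAt_neg (-xM))) (by simpa)).const_mul hlam
  have hump₁ : IsHump F' x₂s := dip₁.isHump dF' hF'0 h₂ (by simp [hF', hFx₂s])
  have hump₂ : IsHump G' (-x₁s) :=
    dip₂.isHump dG' hG'0 (neg_lt_neg h₁') (by simp [hG', hFx₁s])
  have key : ∀ {x z x' z' : ℝ → ℝ} {t₀ t₁ t₂ r₀ r₁ r₂ : ℝ}, LienardCycle F' G' x z t₀ t₁ t₂ →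
      LienardCycle F' G' x' z' r₀ r₁ r₂ → ¬ z t₀ < z' r₀ := by
    intro x z x' z' t₀ t₁ t₂ r₀ r₁ r₂ C D
    rcases hD with ⟨-, -, e⟩ | ⟨-, -, e⟩ | ⟨a, m⟩ | ⟨a, m, le⟩
    · rw [e, neg_neg] at hump₂
      exact C.not_lt_of_isHump dF' dG' cdF' cdG' D hump₁ hump₂
    · rw [e, neg_neg] at dip₂
      exact C.not_lt_of_isDip dF' dG' cdF' cdG' D hF'0 hG'0 dip₁ dip₂
    · exact C.not_lt_of_mono dF' dG' cf' cg' cdF' cdG' D hF'0 hG'0 dip₁ dip₂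
        (fun u hu v hv huv => mul_le_mul_of_nonneg_left (m hu hv huv) hlam.le)
        (fun u hu v hv huv => mul_le_mul_of_nonneg_left
          (a (Set.mem_Iio.2 (neg_lt_zero.2 hv)) (Set.mem_Iio.2 (neg_lt_zero.2 hu))
            (neg_le_neg huv)) hlam.le)
    · refine C.not_lt_of_ratio_mono dF' dG' cf' cg' cdF' cdG' D hump₁ hump₂ le
        (fun u v hu huv => ?_) (fun u v hu huv => ?_)
      · have hu₀ : 0 < u := hump₁.pos.trans_le hu
        have := m hu (hu.trans huv.le) huv.le
        rw [div_le_div_iff₀ hu₀ (hu₀.trans huv)] at this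
        linarith [mul_le_mul_of_nonneg_left this hlam.le]
      · have := a (neg_lt_zero.2 (hu.trans huv)) (neg_lt_zero.2 hu) (neg_le_neg huv.le)
        simp only [div_neg] at this
        rw [neg_le_neg_iff, div_le_div_iff₀ (hu.trans huv) hu] at this
        linarith [mul_le_mul_of_nonneg_left this hlam.le]
  have n₁ := key C D
  have n₂ := key D C
  have hz := le_antisymm (not_lt.1 n₂) (not_lt.1 n₁)
  have hx := C.right.x₀.trans D.right.x₀.symm
  have shift := (hS.isSol dF).eq_shift cdF' (hS'.isSol dF) hx hz
  have eq : ∀ t, (x (t₀ + t), y (t₀ + t)) = (x' (r₀ + t), y' (r₀ + t)) := fun t => by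
    obtain ⟨ex, ez⟩ := shift t
    simp only [ex] at ez
    rw [ex, add_right_cancel ez]
  ext p
  constructor
  · rintro ⟨t, rfl⟩
    exact ⟨r₀ + (t - t₀), by simp only [← eq, add_sub_cancel]⟩
  · rintro ⟨t, rfl⟩
    exact ⟨t₀ + (t - r₀), by simp only [eq, add_sub_cancel]⟩
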